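/- arXiv:1705.03117 — 2 statements merged into one kernel-verified Lean document; each statement's English description precedes it below -/
import Mathlib

section
/- Let g be a finite-dimensional complex semisimple Lie algebra with Cartan subalgebra h, root system R, root spaces g^α, and a fixed set of simple roots S, and let E ∈ h be the grading element with α(E) = 1 for every α ∈ S (so that a root α satisfies α(E) = 1 if and only if α is simple). Then for a Levi subalgebra l of g containing h, with decomposition l = z ⊕ l^ss into center and semisimple factor and projection π^ss : l → l^ss, the element Z := 2·π^ss(E) is a distinguished grading element of l^ss if and only if l^ss admits a set of simple roots contained in S. Consequently, the assignment sending a subset S' ⊆ S to the Levi subalgebra h ⊕ ⊕_{α ∈ R ∩ span_ℤ S'} g^α is a bijection from the power set of S onto the set of Levi subalgebras l ⊇ h for which 2·π^ss(E) is a distinguished grading element of l^ss. -/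
/-- The root space `g^α = {x ∈ g | [h,x] = α(h)·x for all h ∈ H}` of a linear
functional `α` on a Cartan subalgebra `H`. -/
def rootSp {L : Type*} [LieRing L] [LieAlgebra ℂ L]
    (H : LieSubalgebra ℂ L) (α : Module.Dual ℂ H) : Submodule ℂ L where
  carrier := {x | ∀ h : H, ⁅(h : L), x⁆ = α h • x}
  add_mem' := by
    intro a b ha hb h
    rw [lie_add, ha h, hb h, smul_add]
  zero_mem' := by intro h; rw [lie_zero, smul_zero]
  smul_mem' := by
    intro c x hx h
    rw [lie_smul, hx h, smul_comm]

/-- The commutator subspace `[l, l]` (the semisimple factor `l^ss` of a Levi). -/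
def commSpan {L : Type*} [LieRing L] [LieAlgebra ℂ L] (l : Submodule ℂ L) :
    Submodule ℂ L :=
  Submodule.span ℂ {z | ∃ u ∈ l, ∃ v ∈ l, z = ⁅u, v⁆}

/-- The center `z` of the subalgebra `l`. -/
def centerOf {L : Type*} [LieRing L] [LieAlgebra ℂ L] (l : Submodule ℂ L) :
    Submodule ℂ L where
  carrier := {z | z ∈ l ∧ ∀ w ∈ l, ⁅z, w⁆ = 0}
  add_mem' := by
    rintro a b ⟨ha, ha'⟩ ⟨hb, hb'⟩
    exact ⟨l.add_mem ha hb, fun w hw => by rw [add_lie, ha' w hw, hb' w hw, add_zero]⟩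
  zero_mem' := ⟨l.zero_mem, fun w _ => zero_lie w⟩
  smul_mem' := by
    rintro c x ⟨hx, hx'⟩
    exact ⟨l.smul_mem c hx, fun w hw => by rw [smul_lie, hx' w hw, smul_zero]⟩

/-- The `ad Z`-eigenspace `m_ℓ = {x ∈ m | [Z,x] = ℓ·x}`. -/
def adEig {L : Type*} [LieRing L] [LieAlgebra ℂ L]
    (m : Submodule ℂ L) (Z : L) (ℓ : ℤ) : Submodule ℂ L where
  carrier := {x | x ∈ m ∧ ⁅Z, x⁆ = (ℓ : ℂ) • x}
  add_mem' := by
    rintro a b ⟨ha, ha'⟩ ⟨hb, hb'⟩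
    exact ⟨m.add_mem ha hb, by rw [lie_add, ha', hb', smul_add]⟩
  zero_mem' := ⟨m.zero_mem, by rw [lie_zero, smul_zero]⟩
  smul_mem' := by
    rintro c x ⟨hx, hx'⟩
    exact ⟨m.smul_mem c hx, by rw [lie_smul, hx', smul_comm]⟩

/-- `Z` is a distinguished grading element of (the semisimple Lie algebra) `m`:
`Z ∈ m`, `ad Z` acts on `m` semisimply with integer eigenvalues (`m = ⊕_ℓ m_ℓ`),
`dim m₀ = dim m₂`, and `m₂` generates `⊕_{ℓ>0} m_ℓ` as a Lie algebra. -/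
def IsDistinguishedOn {L : Type*} [LieRing L] [LieAlgebra ℂ L]
    (m : Submodule ℂ L) (Z : L) : Prop :=
  Z ∈ m ∧
  (⨆ ℓ : ℤ, adEig m Z ℓ) = m ∧
  Module.finrank ℂ (adEig m Z 0) = Module.finrank ℂ (adEig m Z 2) ∧
  (⨆ ℓ : ℤ, ⨆ _ : 0 < ℓ, adEig m Z ℓ) ≤
    (LieSubalgebra.lieSpan ℂ L (adEig m Z 2 : Set L)).toSubmodule

/-- `l` is a Levi subalgebra containing the Cartan `H`:
`l = H ⊕ ⊕_{α ∈ R, α(x) = 0} g^α` for some `x ∈ H`. -/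
def IsLeviOf {L : Type*} [LieRing L] [LieAlgebra ℂ L]
    (H : LieSubalgebra ℂ L) (R : Finset (Module.Dual ℂ H))
    (l : Submodule ℂ L) : Prop :=
  ∃ x : H, l = H.toSubmodule ⊔ ⨆ α ∈ R, ⨆ _ : α x = 0, rootSp H α

/-- The Levi subalgebra `h ⊕ ⊕_{α ∈ R ∩ span_ℤ S'} g^α` attached to a subset `S'` of
the simple roots. -/
noncomputable def leviOf {L : Type*} [LieRing L] [LieAlgebra ℂ L]
    (H : LieSubalgebra ℂ L) (R : Finset (Module.Dual ℂ H))
    (S' : Finset (Module.Dual ℂ H)) : Submodule ℂ L :=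
  H.toSubmodule ⊔
    ⨆ α ∈ R, ⨆ _ : α ∈ Submodule.span ℤ (S' : Set (Module.Dual ℂ H)), rootSp H α

/-- `S'` is a set of simple roots for the subalgebra `l`: the elements of `S'` are
roots of `l`, linearly independent, and every root of `l` is a nonnegative or a
nonpositive integral combination of elements of `S'`. -/
def IsSimpleSystemFor {L : Type*} [LieRing L] [LieAlgebra ℂ L]
    (H : LieSubalgebra ℂ L) (R : Finset (Module.Dual ℂ H))
    (l : Submodule ℂ L) (S' : Finset (Module.Dual ℂ H)) : Prop :=
  (∀ β ∈ S', β ∈ R ∧ rootSp H β ≤ l) ∧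
  LinearIndependent ℂ (fun β : (S' : Set (Module.Dual ℂ H)) => (β : Module.Dual ℂ H)) ∧
  (∀ α ∈ R, rootSp H α ≤ l →
    (∃ c : Module.Dual ℂ H → ℕ, α = ∑ β ∈ S', c β • β) ∨
    (∃ c : Module.Dual ℂ H → ℕ, α = - ∑ β ∈ S', c β • β))

/-- `Z := 2·π^ss(E)` is a distinguished grading element of `l^ss`: writing
`E = E_z + E_ss` with `E_z` in the center of `l` and `E_ss ∈ l^ss = [l,l]`, the
element `2·E_ss` is a distinguished grading element of `l^ss`. -/
def ZDistinguished {L : Type*} [LieRing L] [LieAlgebra ℂ L]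
    (l : Submodule ℂ L) (E : L) : Prop :=
  ∃ Ess ∈ commSpan l, (E - Ess) ∈ centerOf l ∧
    IsDistinguishedOn (commSpan l) ((2 : ℂ) • Ess)

namespace LeviSimple

open LieAlgebra LieAlgebra.IsKilling LieModule Module

section GeneralLemmas

/-- If `v = a + b` lies in an eigenspace, with `a` in the same eigenspace and `b` in the span of the
other eigenspaces, then `v = a`. -/
lemma mem_left_of_mem_sup_of_mem_eigenspace {V : Type*} [AddCommGroup V] [Module ℂ V]
    (f : End ℂ V) (μ : ℂ) {A B : Submodule ℂ V} (hA : A ≤ f.eigenspace μ)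
    (hB : B ≤ ⨆ ν, ⨆ _ : ν ≠ μ, f.eigenspace ν) {v : V} (hv : v ∈ A ⊔ B)
    (hv' : v ∈ f.eigenspace μ) : v ∈ A := by
  obtain ⟨a, ha, b, hb, rfl⟩ := Submodule.mem_sup.mp hv
  have hbμ : b ∈ f.eigenspace μ := by simpa using sub_mem hv' (hA ha)
  have hb0 : b = 0 :=
    Submodule.disjoint_def.mp (f.eigenspaces_iSupIndep μ) b hbμ (hB hb)
  simpa [hb0] using ha

/-- A linearly independent finite set of functionals can be given arbitrary values. -/
lemma exists_apply_eq {V : Type*} [AddCommGroup V] [Module ℂ V] [FiniteDimensional ℂ V]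
    {S : Set (Dual ℂ V)} (hS : LinearIndependent ℂ fun β : S ↦ (β : Dual ℂ V))
    (g : Dual ℂ V → ℂ) : ∃ x : V, ∀ β ∈ S, β x = g β := by
  obtain ⟨f, hf⟩ := LinearMap.exists_extend ((Basis.span hS).constr ℂ fun β ↦ g β)
  refine ⟨(evalEquiv ℂ V).symm f, fun β hβ ↦ ?_⟩
  have h1 := LinearMap.congr_fun hf (Basis.span hS ⟨β, hβ⟩)
  rw [Basis.constr_basis, LinearMap.comp_apply, Submodule.subtype_apply, Basis.span_apply] at h1
  rw [← h1]
  exact apply_evalEquiv_symm_apply ℂ V β f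

lemma mem_of_mem_span_int {V : Type*} [AddCommGroup V] [Module ℂ V] {S S' : Finset V}
    (hS : LinearIndependent ℂ fun β : (S : Set V) ↦ (β : V)) (hS' : S' ⊆ S) {β : V} (hβ : β ∈ S)
    (h : β ∈ Submodule.span ℤ (S' : Set V)) : β ∈ S' := by
  by_contra hβ'
  refine LinearIndepOn.notMem_span_of_insert (R := ℂ) (v := id) (s := (S' : Set V)) (i := β)
    (LinearIndepOn.mono hS ?_) hβ' ?_
  · simpa [Set.insert_subset_iff, hβ] using hS'
  · simpa using Submodule.span_le_restrictScalars ℤ ℂ _ h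

end GeneralLemmas

variable {L : Type*} [LieRing L] [LieAlgebra ℂ L] {H : LieSubalgebra ℂ L}

lemma lie_mem_rootSp {χ ψ : Dual ℂ H} {x y : L} (hx : x ∈ rootSp H χ) (hy : y ∈ rootSp H ψ) :
    ⁅x, y⁆ ∈ rootSp H (χ + ψ) := by
  intro h
  rw [leibniz_lie, hx h, hy h, smul_lie, lie_smul, LinearMap.add_apply, add_smul]

variable (H) in
/-- The sum of the root spaces whose weights satisfy `P`. -/
def rootSum (P : Dual ℂ H → Prop) : Submodule ℂ L := ⨆ χ, ⨆ _ : P χ, rootSp H χ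

lemma rootSp_le_rootSum {P : Dual ℂ H → Prop} {χ : Dual ℂ H} (h : P χ) :
    rootSp H χ ≤ rootSum H P := le_iSup₂_of_le χ h le_rfl

lemma rootSum_le {P : Dual ℂ H → Prop} {N : Submodule ℂ L} :
    rootSum H P ≤ N ↔ ∀ χ, P χ → rootSp H χ ≤ N := iSup₂_le_iff

lemma rootSum_mono {P Q : Dual ℂ H → Prop} (h : ∀ χ, rootSp H χ ≠ ⊥ → P χ → Q χ) :
    rootSum H P ≤ rootSum H Q := by
  refine rootSum_le.mpr fun χ hχ ↦ ?_
  by_cases hbot : rootSp H χ = ⊥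
  · simp [hbot]
  · exact rootSp_le_rootSum (h χ hbot hχ)

lemma lie_mem_of_mem_rootSum {P Q : Dual ℂ H → Prop} {N : Submodule ℂ L}
    (h : ∀ χ ψ, P χ → Q ψ → ∀ x ∈ rootSp H χ, ∀ y ∈ rootSp H ψ, ⁅x, y⁆ ∈ N)
    {x y : L} (hx : x ∈ rootSum H P) (hy : y ∈ rootSum H Q) : ⁅x, y⁆ ∈ N := by
  have h₁ : ∀ ψ, Q ψ → ∀ y ∈ rootSp H ψ, ∀ x ∈ rootSum H P, ⁅x, y⁆ ∈ N := by
    intro ψ hψ y hy x hx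
    have : rootSum H P ≤ N.comap ((LieAlgebra.ad ℂ L) y : End ℂ L) := by
      refine rootSum_le.mpr fun χ hχ x hx ↦ ?_
      simpa using N.neg_mem (h χ ψ hχ hψ x hx y hy)
    simpa using N.neg_mem (this hx)
  have : rootSum H Q ≤ N.comap ((LieAlgebra.ad ℂ L) x : End ℂ L) :=
    rootSum_le.mpr fun ψ hψ y hy ↦ h₁ ψ hψ y hy x hx
  exact this hy

variable (H) in
/-- A nonzero weight with nonzero root space. -/
def IsRoot (χ : Dual ℂ H) : Prop := χ ≠ 0 ∧ rootSp H χ ≠ ⊥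

section Cartan

variable [H.IsCartanSubalgebra]

variable (H) in
lemma rootSp_le_rootSpace (χ : Dual ℂ H) :
    rootSp H χ ≤ (rootSpace H (χ : H → ℂ)).toSubmodule := by
  intro x hx
  have : x ∈ weightSpace L (χ : H → ℂ) := (mem_weightSpace (χ : H → ℂ) x).mpr fun h ↦ hx h
  exact weightSpace_le_genWeightSpace L _ this

variable (H) in
lemma iSupIndep_rootSp : iSupIndep (rootSp H) := by
  have h := LieSubmodule.iSupIndep_toSubmodule.mpr (iSupIndep_genWeightSpace ℂ H L)
  exact (h.comp (f := fun χ : Dual ℂ H ↦ (χ : H → ℂ)) DFunLike.coe_injective).mono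
    (rootSp_le_rootSpace H)

lemma rootSp_le_rootSum_iff {P : Dual ℂ H → Prop} {χ : Dual ℂ H} (hχ : rootSp H χ ≠ ⊥) :
    rootSp H χ ≤ rootSum H P ↔ P χ := by
  refine ⟨fun h ↦ by_contra fun hP ↦ hχ ?_, rootSp_le_rootSum⟩
  have h' : rootSum H P ≤ ⨆ ψ, ⨆ _ : ψ ≠ χ, rootSp H ψ :=
    iSup₂_le fun ψ hψ ↦ le_iSup₂_of_le ψ (by rintro rfl; exact hP hψ) le_rfl
  exact disjoint_self.mp ((iSupIndep_rootSp H χ).mono_right (h.trans h'))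

end Cartan

section Killing

variable [FiniteDimensional ℂ L] [IsKilling ℂ L] [H.IsCartanSubalgebra]

lemma rootSp_eq_rootSpace (χ : Dual ℂ H) :
    rootSp H χ = (rootSpace H (χ : H → ℂ)).toSubmodule :=
  le_antisymm (rootSp_le_rootSpace H χ) fun _ hx h ↦ lie_eq_smul_of_mem_rootSpace hx h

variable (H) in
lemma rootSp_zero : rootSp H 0 = H.toSubmodule := by
  rw [rootSp_eq_rootSpace]
  have := rootSpace_zero_eq ℂ L H
  have h0 : ((0 : Dual ℂ H) : H → ℂ) = 0 := rfl
  rw [h0, this]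
  rfl

/-- A weight of the adjoint action attached to a root. -/
def IsRoot.weight {χ : Dual ℂ H} (h : IsRoot H χ) : Weight ℂ H L where
  toFun := χ
  genWeightSpace_ne_bot' := fun h' ↦ h.2 <| by
    rw [rootSp_eq_rootSpace]
    exact (LieSubmodule.toSubmodule_eq_bot _).mpr h'

lemma IsRoot.coe_weight {χ : Dual ℂ H} (h : IsRoot H χ) : (h.weight : H → ℂ) = χ := rfl

lemma IsRoot.toLinear_weight {χ : Dual ℂ H} (h : IsRoot H χ) : h.weight.toLinear = χ := rfl

lemma IsRoot.isNonZero {χ : Dual ℂ H} (h : IsRoot H χ) : h.weight.IsNonZero := fun h0 ↦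
  h.1 <| DFunLike.coe_injective h0

lemma IsRoot.neg {χ : Dual ℂ H} (h : IsRoot H χ) : IsRoot H (-χ) := by
  refine ⟨neg_ne_zero.mpr h.1, ?_⟩
  rw [rootSp_eq_rootSpace]
  have := (-h.weight).genWeightSpace_ne_bot
  exact fun h' ↦ this ((LieSubmodule.toSubmodule_eq_bot _).mp h')

lemma isRoot_toLinear {α : Weight ℂ H L} (h : α.IsNonZero) : IsRoot H α.toLinear := by
  refine ⟨fun h0 ↦ h (by ext x; exact LinearMap.congr_fun h0 x), ?_⟩
  rw [rootSp_eq_rootSpace]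
  exact fun h' ↦ α.genWeightSpace_ne_bot _ ((LieSubmodule.toSubmodule_eq_bot _).mp h')

lemma IsRoot.exists_eq_smul {χ : Dual ℂ H} (h : IsRoot H χ) {x y : L} (hx : x ∈ rootSp H χ)
    (hx0 : x ≠ 0) (hy : y ∈ rootSp H χ) : ∃ c : ℂ, c • x = y := by
  have h1 := finrank_rootSpace_eq_one h.weight h.isNonZero
  rw [rootSp_eq_rootSpace] at hx hy
  obtain ⟨c, hc⟩ := (finrank_eq_one_iff_of_nonzero' (⟨x, hx⟩ : rootSpace H h.weight)
    fun h0 ↦ hx0 (congrArg Subtype.val h0)).mp h1 ⟨y, hy⟩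
  exact ⟨c, congrArg Subtype.val hc⟩

/-- Bracketing with a root vector of `β` reaches the root space of `α` whenever `α` pairs positively
with the coroot of `β`. -/
lemma exists_lie_ne_zero_of_pairing_pos (α β : Weight ℂ H L) (hβ : β.IsNonZero) {n : ℤ}
    (hn : 0 < n) (hαβ : α (coroot β) = n) :
    ∃ e ∈ rootSp H β.toLinear, ∃ y ∈ rootSp H (α.toLinear - β.toLinear),
      ⁅e, y⁆ ∈ rootSp H α.toLinear ∧ ⁅e, y⁆ ≠ 0 := by
  obtain ⟨h, e, f, t, he, hf⟩ := exists_isSl2Triple_of_weight_isNonZero hβ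
  obtain rfl := t.h_eq_coroot hβ he hf
  obtain ⟨w, hw, hw0⟩ := (chainTop β α).exists_ne_zero
  have P : t.HasPrimitiveVectorWith w (chainLength β α : ℂ) := by
    refine ⟨hw0, (chainLength_smul β α hw).symm, ?_⟩
    have := lie_mem_genWeightSpace_of_mem_genWeightSpace he hw
    rwa [genWeightSpace_add_chainTop β α hβ] at this
  set k := chainTopCoeff β α
  have hk : (chainLength β α : ℤ) - 2 * k = n := by
    have := apply_coroot_eq_cast' β α
    rw [hαβ] at this
    exact_mod_cast this.symm
  have hf' : f ∈ rootSp H (-β.toLinear) := by rw [rootSp_eq_rootSpace]; exact hf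
  have he' : e ∈ rootSp H β.toLinear := by rw [rootSp_eq_rootSpace]; exact he
  have hpow (i : ℕ) : ((toEnd ℂ L L f) ^ i) w ∈
      rootSp H (α.toLinear + ((k : ℂ) - i) • β.toLinear) := by
    induction i with
    | zero =>
      intro h
      simpa [add_comm] using lie_eq_smul_of_mem_rootSpace hw h
    | succ i ih =>
      rw [pow_succ', Module.End.mul_apply, toEnd_apply_apply]
      convert! lie_mem_rootSp hf' ih using 2
      push_cast
      module
  have hx := hpow k
  have hy := hpow (k + 1)
  refine ⟨e, he', _, by convert! hy using 2; push_cast; module, ?_⟩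
  rw [P.lie_e_pow_succ_toEnd_f k]
  refine ⟨Submodule.smul_mem _ _ (by simpa using hx), smul_ne_zero ?_
    (P.pow_toEnd_f_ne_zero_of_eq_nat rfl (by lia))⟩
  refine mul_ne_zero (by exact_mod_cast k.succ_ne_zero) (sub_ne_zero.mpr ?_)
  have : chainLength β α ≠ k := by lia
  exact_mod_cast this

end Killing

variable (H) in
/-- The sum of the root spaces with weights in an additive submonoid, as a Lie subalgebra. -/
def rootSumLie (M : AddSubmonoid (Dual ℂ H)) : LieSubalgebra ℂ L where
  __ := rootSum H (· ∈ M)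
  lie_mem' := fun hx hy ↦ lie_mem_of_mem_rootSum
    (fun _ _ hχ hψ _ hx _ hy ↦ rootSp_le_rootSum (M.add_mem hχ hψ) (lie_mem_rootSp hx hy)) hx hy

lemma rootSp_le_eigenspace (χ : Dual ℂ H) (Z : H) :
    rootSp H χ ≤ End.eigenspace (LieAlgebra.ad ℂ L (Z : L)) (χ Z) :=
  fun _ hv ↦ End.mem_eigenspace_iff.mpr (hv Z)

/-- The eigenvectors of `ad Z`, for `Z ∈ H`, in a sum of root spaces lie in the sum of those
root spaces on which `Z` acts by the given eigenvalue. -/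
lemma mem_rootSum_of_lie_eq {P : Dual ℂ H → Prop} {Z : H} {μ : ℂ} {v : L} (hv : v ∈ rootSum H P)
    (h : ⁅(Z : L), v⁆ = μ • v) : v ∈ rootSum H (fun χ ↦ P χ ∧ χ Z = μ) := by
  refine mem_left_of_mem_sup_of_mem_eigenspace (LieAlgebra.ad ℂ L (Z : L)) μ
    (B := rootSum H (fun χ ↦ P χ ∧ χ Z ≠ μ)) ?_ ?_ ?_ (End.mem_eigenspace_iff.mpr h)
  · refine rootSum_le.mpr ?_
    rintro χ ⟨-, rfl⟩
    exact rootSp_le_eigenspace χ Z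
  · refine rootSum_le.mpr fun χ hχ ↦ ?_
    exact (rootSp_le_eigenspace χ Z).trans (le_iSup₂_of_le (χ Z) hχ.2 le_rfl)
  · refine (rootSum_le.mpr fun χ hχ ↦ ?_ :
      rootSum H P ≤ rootSum H (fun χ ↦ P χ ∧ χ Z = μ) ⊔ rootSum H (fun χ ↦ P χ ∧ χ Z ≠ μ)) hv
    by_cases h : χ Z = μ
    · exact (rootSp_le_rootSum (P := fun χ ↦ P χ ∧ χ Z = μ) ⟨hχ, h⟩).trans le_sup_left
    · exact (rootSp_le_rootSum (P := fun χ ↦ P χ ∧ χ Z ≠ μ) ⟨hχ, h⟩).trans le_sup_right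

lemma rootSp_le_commSpan {l : Submodule ℂ L} (hHl : H.toSubmodule ≤ l) {χ : Dual ℂ H} (hχ : χ ≠ 0)
    (h : rootSp H χ ≤ l) : rootSp H χ ≤ commSpan l := by
  intro v hv
  obtain ⟨z, hz⟩ := DFunLike.ne_iff.mp hχ
  have hz : χ z ≠ 0 := hz
  have : v = (χ z)⁻¹ • ⁅(z : L), v⁆ := by rw [hv z, smul_smul, inv_mul_cancel₀ hz, one_smul]
  rw [this]
  exact Submodule.smul_mem _ _ (Submodule.subset_span ⟨z, hHl z.2, v, h hv, rfl⟩)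

variable (H) in
/-- The Levi subalgebra centralizing `x`. -/
def levi (x : H) : Submodule ℂ L := rootSum H (fun χ ↦ χ x = 0)

lemma commSpan_levi_le (x : H) : commSpan (levi H x) ≤ levi H x := by
  refine Submodule.span_le.mpr ?_
  rintro _ ⟨u, hu, v, hv, rfl⟩
  refine lie_mem_of_mem_rootSum (fun χ ψ hχ hψ _ hx _ hy ↦ rootSp_le_rootSum ?_
    (lie_mem_rootSp hx hy)) hu hv
  simp [hχ, hψ]

lemma eq_of_sub_mem_centerOf_levi {x E Z : H} (h : (E : L) - Z ∈ centerOf (levi H x))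
    {α : Dual ℂ H} (hα : IsRoot H α) (hαx : α x = 0) : α Z = α E := by
  obtain ⟨v, hv, hv0⟩ := (Submodule.ne_bot_iff _).mp hα.2
  have := h.2 v (rootSp_le_rootSum hαx hv)
  rw [sub_lie, hv E, hv Z, ← sub_smul] at this
  exact (sub_eq_zero.mp ((smul_eq_zero.mp this).resolve_right hv0)).symm

lemma adEig_le {x E Z : H} (hZ : ∀ α, IsRoot H α → α x = 0 → α Z = α E) {N : Submodule ℂ L} {ℓ : ℤ}
    (hℓ : ℓ ≠ 0) (hN : ∀ α, IsRoot H α → α x = 0 → 2 * α E = ℓ → rootSp H α ≤ N) :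
    adEig (commSpan (levi H x)) ((2 : ℂ) • (Z : L)) ℓ ≤ N := by
  rintro v ⟨hv, hv2⟩
  refine (rootSum_le.mpr fun χ hχ ↦ ?_ : _ ≤ N)
    (mem_rootSum_of_lie_eq (Z := (2 : ℂ) • Z) (commSpan_levi_le x hv) hv2)
  by_cases hbot : rootSp H χ = ⊥
  · simp [hbot]
  have hχ0 : χ ≠ 0 := by
    rintro rfl
    exact hℓ (by simpa [eq_comm] using hχ.2)
  have hroot : IsRoot H χ := ⟨hχ0, hbot⟩
  exact hN χ hroot hχ.1 (by rw [← hZ χ hroot hχ.1]; simpa using hχ.2)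

section Killing

variable [FiniteDimensional ℂ L] [IsKilling ℂ L] [H.IsCartanSubalgebra]

lemma le_levi (x : H) : H.toSubmodule ≤ levi H x := by
  rw [← rootSp_zero H]
  exact rootSp_le_rootSum rfl

lemma sub_mem_centerOf_levi {x E Z : H} (hZ : ∀ α, IsRoot H α → α x = 0 → α Z = α E) :
    (E : L) - Z ∈ centerOf (levi H x) := by
  refine ⟨le_levi x (E - Z).2, fun w hw ↦ ?_⟩
  have : levi H x ≤ LinearMap.ker (LieAlgebra.ad ℂ L ((E - Z : H) : L)) := by
    refine rootSum_le.mpr fun χ hχ w hw ↦ ?_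
    have h := hw (E - Z)
    by_cases hw0 : w = 0
    · simp [hw0]
    suffices χ (E - Z) = 0 by
      rw [this, zero_smul] at h
      exact h
    by_cases hχ0 : χ = 0
    · simp [hχ0]
    · rw [map_sub, hZ χ ⟨hχ0, (Submodule.ne_bot_iff _).mpr ⟨w, hw, hw0⟩⟩ hχ, sub_self]
  exact this hw

lemma rootSp_le_adEig {x E Z : H} (hZ : ∀ α, IsRoot H α → α x = 0 → α Z = α E) {α : Dual ℂ H}
    (hα : IsRoot H α) (hαx : α x = 0) {k : ℤ} (hk : α E = k) :
    rootSp H α ≤ adEig (commSpan (levi H x)) ((2 : ℂ) • (Z : L)) (2 * k) := by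
  refine fun v hv ↦ ⟨rootSp_le_commSpan (le_levi x) hα.1 (rootSp_le_rootSum hαx) hv, ?_⟩
  rw [smul_lie, hv Z, hZ α hα hαx, hk, smul_smul]
  push_cast
  rfl

lemma exists_coe_eq_of_sub_mem_centerOf_levi {x E : H} {Ess : L}
    (h : (E : L) - Ess ∈ centerOf (levi H x)) : ∃ Z : H, (Z : L) = Ess := by
  have : Ess ∈ H.toSubmodule := by
    rw [← rootSp_zero H]
    intro z
    have hz := h.2 z (le_levi x z.2)
    have hE : ⁅(z : L), (E : L)⁆ = (0 : Dual ℂ H) z • (E : L) :=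
      (rootSp_zero H ▸ E.2 : (E : L) ∈ rootSp H 0) z
    rw [sub_lie, sub_eq_zero] at hz
    rw [← lie_skew, ← hz, lie_skew, hE]
    simp
  exact ⟨⟨Ess, this⟩, rfl⟩

/-- If twice the semisimple part of `E` is distinguished in the Levi subalgebra of `x`, then the
roots of the Levi subalgebra on which `E` is positive are sums of elements of `S`. -/
lemma mem_closure_of_zDistinguished {x E : H} {S : Set (Dual ℂ H)}
    (hE : ∀ α, IsRoot H α → α E = 1 → α ∈ S) (hl : ZDistinguished (levi H x) (E : L))
    {α : Dual ℂ H} (hα : IsRoot H α) (hαx : α x = 0) {k : ℤ} (hk : 0 < k) (hαE : α E = k) :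
    α ∈ AddSubmonoid.closure {β ∈ S | β x = 0} := by
  obtain ⟨Ess, -, hcent, -, -, -, hgen⟩ := hl
  obtain ⟨Z, rfl⟩ := exists_coe_eq_of_sub_mem_centerOf_levi hcent
  set M := AddSubmonoid.closure {β ∈ S | β x = 0}
  have h2 : adEig (commSpan (levi H x)) ((2 : ℂ) • (Z : L)) 2 ≤ rootSum H (· ∈ M) :=
    adEig_le (fun _ ↦ eq_of_sub_mem_centerOf_levi hcent) two_ne_zero fun χ hχ hχx h ↦
      rootSp_le_rootSum (AddSubmonoid.subset_closure ⟨hE χ hχ (by simpa using h), hχx⟩)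
  have hlie : (LieSubalgebra.lieSpan ℂ L
      (adEig (commSpan (levi H x)) ((2 : ℂ) • (Z : L)) 2 : Set L)) ≤ rootSumLie H M :=
    LieSubalgebra.lieSpan_le.mpr h2
  refine (rootSp_le_rootSum_iff hα.2).mp (le_trans ?_ (hgen.trans hlie))
  exact le_iSup₂_of_le (2 * k) (by positivity)
    (rootSp_le_adEig (fun _ ↦ eq_of_sub_mem_centerOf_levi hcent) hα hαx hαE)

end Killing

section Coroots

variable [FiniteDimensional ℂ L] [IsKilling ℂ L] [H.IsCartanSubalgebra]
  {ι : Type*} {b : ι → Weight ℂ H L}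

lemma linearIndependent_coroot (hb : ∀ i, (b i).IsNonZero)
    (hli : LinearIndependent ℂ fun i ↦ (b i).toLinear) :
    LinearIndependent ℂ fun i ↦ coroot (b i) := by
  have h := (hli.map' (cartanEquivDual H).symm.toLinearMap
    (cartanEquivDual H).symm.ker).units_smul fun i ↦ Units.mk0
      (2 * (b i ((cartanEquivDual H).symm (b i).toLinear))⁻¹)
      (mul_ne_zero two_ne_zero (inv_ne_zero (root_apply_cartanEquivDual_symm_ne_zero (hb i))))
  convert! h using 2 with i
  simp [coroot, mul_smul, two_smul, Units.smul_def]

lemma eq_zero_of_forall_apply_eq_zero {c : H} (h : ∀ γ : Weight ℂ H L, γ c = 0) : c = 0 := by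
  have : c ∈ ⨅ γ : Weight ℂ H L, γ.ker := (Submodule.mem_iInf _).mpr h
  rwa [iInf_ker_weight_eq_bot, Submodule.mem_bot] at this

variable [Fintype ι]

/-- A combination of coroots killed by the corresponding roots vanishes. -/
lemma sum_smul_coroot_eq_zero {a : ι → ℂ} (h : ∀ j, b j (∑ i, a i • coroot (b i)) = 0) :
    ∑ i, a i • coroot (b i) = 0 := by
  set c := ∑ i, a i • coroot (b i) with hc
  set c' := ∑ i, (starRingEnd ℂ) (a i) • coroot (b i) with hc'
  have hconj (γ : Weight ℂ H L) : γ c' = (starRingEnd ℂ) (γ c) := by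
    rw [← Weight.toLinear_apply, ← Weight.toLinear_apply, hc, hc', map_sum, map_sum, map_sum]
    refine Finset.sum_congr rfl fun i _ ↦ ?_
    simp [apply_coroot_eq_cast]
  have h0 : traceForm ℂ H L c' c = 0 := by
    rw [hc', LinearMap.map_sum₂]
    refine Finset.sum_eq_zero fun i _ ↦ ?_
    rw [map_smul, LinearMap.smul_apply, traceForm_coroot, h i]
    simp
  have h1 : ∑ γ ∈ H.root, (starRingEnd ℂ) (γ c) * γ c = 0 := by
    rw [← restrict_killingForm, restrict_killingForm_eq_sum] at h0
    simpa [hconj, LinearMap.sum_apply] using h0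
  have h2 : ∑ γ ∈ H.root, ‖γ c‖ ^ 2 = 0 := by
    simp_rw [Complex.conj_mul'] at h1
    exact_mod_cast h1
  refine eq_zero_of_forall_apply_eq_zero fun γ ↦ ?_
  by_cases hγ : γ.IsZero
  · simp [hγ.eq]
  · have := (Finset.sum_eq_zero_iff_of_nonneg fun _ _ ↦ by positivity).mp h2 γ (by simpa using hγ)
    simpa using this

lemma exists_forall_apply_sum_coroot_eq_one (hb : ∀ i, (b i).IsNonZero)
    (hli : LinearIndependent ℂ fun i ↦ (b i).toLinear) :
    ∃ a : ι → ℂ, ∀ j, b j (∑ i, a i • coroot (b i)) = 1 := by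
  let Φ : (ι → ℂ) →ₗ[ℂ] (ι → ℂ) :=
    LinearMap.pi fun j ↦ (b j).toLinear ∘ₗ Fintype.linearCombination ℂ (fun i ↦ coroot (b i))
  have hinj : Function.Injective Φ := by
    refine (injective_iff_map_eq_zero Φ).mpr fun a ha ↦ ?_
    have := sum_smul_coroot_eq_zero (b := b) (a := a) fun j ↦ congrFun ha j
    exact funext (Fintype.linearIndependent_iff.mp (linearIndependent_coroot hb hli) a this)
  obtain ⟨a, ha⟩ := LinearMap.surjective_of_injective hinj 1
  exact ⟨a, fun j ↦ congrFun ha j⟩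

omit [Fintype ι] in
/-- Positivity of the pairing of two roots is a symmetric condition. -/
lemma exists_pos_apply_coroot_comm {α β : Weight ℂ H L} (hα : α.IsNonZero) (hβ : β.IsNonZero)
    {n : ℤ} (hn : 0 < n) (h : β (coroot α) = n) : ∃ m : ℤ, 0 < m ∧ α (coroot β) = m := by
  let i : H.root := ⟨α, by simpa using hα⟩
  let j : H.root := ⟨β, by simpa using hβ⟩
  have hij (k l : H.root) : (((rootSystem H).pairingIn ℤ k l : ℤ) : ℂ) = k.1 (coroot l.1) := by
    simpa using (rootSystem H).algebraMap_pairingIn ℤ k l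
  refine ⟨(rootSystem H).pairingIn ℤ i j, ((rootSystem H).zero_lt_pairingIn_iff' ℤ).mp ?_,
    (hij i j).symm⟩
  have : (((rootSystem H).pairingIn ℤ j i : ℤ) : ℂ) = n := (hij j i).trans h
  rwa [Int.cast_injective this]

end Coroots

section Simple

variable [FiniteDimensional ℂ L] [H.IsCartanSubalgebra] {ι : Type*} [Fintype ι]

/-- The family `b` is a system of simple roots of the Levi subalgebra of `x`, and `E` takes the value
`1` on each of its members. -/
structure IsSimpleFamily (x E : H) (b : ι → Weight ℂ H L) : Prop where
  isNonZero : ∀ i, (b i).IsNonZero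
  linearIndependent : LinearIndependent ℂ fun i ↦ (b i).toLinear
  apply_left : ∀ i, b i x = 0
  apply_right : ∀ i, b i E = 1
  exists_eq : ∀ α, IsRoot H α → α x = 0 →
    ∃ c : ι → ℕ, α = ∑ i, c i • (b i).toLinear ∨ α = -∑ i, c i • (b i).toLinear

namespace IsSimpleFamily

variable {x E : H} {b : ι → Weight ℂ H L} (hb : IsSimpleFamily x E b)

include hb

lemma sum_apply (c : ι → ℕ) : (∑ i, c i • (b i).toLinear) E = (∑ i, c i : ℕ) := by
  simp [LinearMap.sum_apply, hb.apply_right]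

lemma mem_span {α : Dual ℂ H} (hα : IsRoot H α) (hαx : α x = 0) :
    α ∈ Submodule.span ℂ (Set.range fun i ↦ (b i).toLinear) := by
  have h (c : ι → ℕ) : ∑ i, c i • (b i).toLinear ∈
      Submodule.span ℂ (Set.range fun i ↦ (b i).toLinear) :=
    Submodule.sum_mem _ fun i _ ↦ Submodule.smul_of_tower_mem _ _ (Submodule.subset_span ⟨i, rfl⟩)
  obtain ⟨c, rfl | rfl⟩ := hb.exists_eq α hα hαx
  exacts [h c, Submodule.neg_mem _ (h c)]

lemma exists_int {α : Dual ℂ H} (hα : IsRoot H α) (hαx : α x = 0) :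
    ∃ k : ℤ, k ≠ 0 ∧ α E = k := by
  obtain ⟨c, hc⟩ := hb.exists_eq α hα hαx
  have h0 : ∑ i, c i ≠ 0 := by
    intro h0
    have h0 : ∀ i, c i = 0 := by simpa using h0
    exact hα.1 (by simpa [h0] using hc)
  obtain rfl | rfl := hc
  · exact ⟨(∑ i, c i : ℕ), by exact_mod_cast h0, by rw [hb.sum_apply]; simp⟩
  · refine ⟨-(∑ i, c i : ℕ), neg_ne_zero.mpr (by exact_mod_cast h0), ?_⟩
    rw [LinearMap.neg_apply, hb.sum_apply]
    simp

lemma exists_eq_of_pos {α : Dual ℂ H} (hα : IsRoot H α) (hαx : α x = 0) {n : ℕ} (h : α E = n) :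
    ∃ c : ι → ℕ, α = ∑ i, c i • (b i).toLinear ∧ ∑ i, c i = n := by
  obtain ⟨c, rfl | rfl⟩ := hb.exists_eq α hα hαx
  · exact ⟨c, rfl, by rw [hb.sum_apply] at h; exact_mod_cast h⟩
  · obtain ⟨k, hk, hk'⟩ := hb.exists_int hα hαx
    rw [LinearMap.neg_apply, hb.sum_apply] at h hk'
    have h1 : -((∑ i, c i : ℕ) : ℤ) = n := by exact_mod_cast h
    have h2 : -((∑ i, c i : ℕ) : ℤ) = k := by exact_mod_cast hk'
    lia

lemma exists_eq_of_apply_eq_one {α : Dual ℂ H} (hα : IsRoot H α) (hαx : α x = 0) (h : α E = 1) :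
    ∃ i, α = (b i).toLinear := by
  classical
  obtain ⟨c, rfl, hc⟩ := hb.exists_eq_of_pos hα hαx (n := 1) (by simpa using h)
  obtain ⟨i, -, hi⟩ := Finset.exists_ne_zero_of_sum_ne_zero (hc.trans_ne one_ne_zero)
  have hsum := Finset.add_sum_erase Finset.univ c (Finset.mem_univ i)
  have hi1 : c i = 1 := by lia
  have hi' : ∀ j ∈ Finset.univ.erase i, c j = 0 := by
    rw [← Finset.sum_eq_zero_iff]
    lia
  refine ⟨i, ?_⟩
  rw [Finset.sum_eq_single i (fun j hj hji ↦ by rw [hi' j (by simpa using hji), zero_smul])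
    (by simp), hi1, one_smul]

variable [IsKilling ℂ L]

lemma isRoot (i : ι) : IsRoot H (b i).toLinear := isRoot_toLinear (hb.isNonZero i)

omit hb in
variable (b) in
/-- The span of the coroots. -/
def corootSpan : Submodule ℂ L := Submodule.span ℂ (Set.range fun i ↦ (coroot (b i) : L))

lemma symm_mem_corootSpan {α : Dual ℂ H} (hα : IsRoot H α) (hαx : α x = 0) :
    ((cartanEquivDual H).symm α : L) ∈ corootSpan b := by
  have : Submodule.span ℂ (Set.range fun i ↦ (b i).toLinear) ≤
      (corootSpan b).comap (H.toSubmodule.subtype ∘ₗ (cartanEquivDual H).symm.toLinearMap) := by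
    refine Submodule.span_le.mpr ?_
    rintro _ ⟨i, rfl⟩
    set t := (cartanEquivDual H).symm (b i).toLinear with ht
    have h0 : b i t ≠ 0 := root_apply_cartanEquivDual_symm_ne_zero (hb.isNonZero i)
    have h1 : (t : L) = (b i t / 2) • (coroot (b i) : L) := by
      rw [coroot, ← ht, two_smul, ← two_smul ℂ, smul_smul]
      push_cast
      rw [smul_smul, show b i t / 2 * (2 * (b i t)⁻¹) = 1 by field_simp, one_smul]
    change (t : L) ∈ corootSpan b
    rw [h1]
    exact Submodule.smul_mem _ _ (Submodule.subset_span ⟨i, rfl⟩)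
  exact this (hb.mem_span hα hαx)

lemma commSpan_levi :
    commSpan (levi H x) = corootSpan b ⊔ rootSum H (fun χ ↦ IsRoot H χ ∧ χ x = 0) := by
  refine le_antisymm (Submodule.span_le.mpr ?_) (sup_le (Submodule.span_le.mpr ?_) ?_)
  · rintro _ ⟨u, hu, v, hv, rfl⟩
    refine lie_mem_of_mem_rootSum (fun χ ψ hχ hψ u hu v hv ↦ ?_) hu hv
    have huv := lie_mem_rootSp hu hv
    by_cases h0 : χ + ψ = 0
    · obtain rfl : ψ = -χ := (neg_eq_of_add_eq_zero_right h0).symm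
      by_cases hχ0 : χ = 0
      · subst hχ0
        rw [rootSp_zero] at hu
        have := hv ⟨u, hu⟩
        simp only [neg_zero, LinearMap.zero_apply, zero_smul] at this
        simp [this]
      · by_cases hu0 : u = 0
        · simp [hu0]
        · have hroot : IsRoot H χ := ⟨hχ0, (Submodule.ne_bot_iff _).mpr ⟨u, hu, hu0⟩⟩
          rw [rootSp_eq_rootSpace] at hu hv
          have := lie_eq_killingForm_smul_of_mem_rootSpace_of_mem_rootSpace_neg
            (α := hroot.weight) hu hv
          rw [this]
          exact Submodule.mem_sup_left
            (Submodule.smul_mem _ _ (hb.symm_mem_corootSpan hroot hχ))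
    · by_cases hbot : rootSp H (χ + ψ) = ⊥
      · rw [hbot, Submodule.mem_bot] at huv
        simp [huv]
      · exact Submodule.mem_sup_right (rootSp_le_rootSum
          (P := fun χ ↦ IsRoot H χ ∧ χ x = 0) ⟨⟨h0, hbot⟩, by simp [hχ, hψ]⟩ huv)
  · rintro _ ⟨i, rfl⟩
    obtain ⟨h, e, f, t, he, hf⟩ := exists_isSl2Triple_of_weight_isNonZero (hb.isNonZero i)
    obtain rfl := t.h_eq_coroot (hb.isNonZero i) he hf
    refine Submodule.subset_span ⟨e, ?_, f, ?_, t.lie_e_f.symm⟩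
    · refine rootSp_le_rootSum (χ := (b i).toLinear) (hb.apply_left i) ?_
      rw [rootSp_eq_rootSpace]
      exact he
    · refine rootSp_le_rootSum (χ := -(b i).toLinear) (by simp [hb.apply_left]) ?_
      rw [rootSp_eq_rootSpace]
      exact hf
  · exact rootSum_le.mpr fun χ hχ ↦
      rootSp_le_commSpan (le_levi x) hχ.1.1 (rootSp_le_rootSum hχ.2)

/-- The element of the span of the coroots on which the simple roots take the value `1`. -/
lemma exists_mem_corootSpan : ∃ Z : H, (Z : L) ∈ corootSpan b ∧
    ∀ α, IsRoot H α → α x = 0 → α Z = α E := by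
  obtain ⟨a, ha⟩ := exists_forall_apply_sum_coroot_eq_one hb.isNonZero hb.linearIndependent
  refine ⟨∑ i, a i • coroot (b i), ?_, fun α hα hαx ↦ ?_⟩
  · push_cast
    exact Submodule.sum_mem _ fun i _ ↦ Submodule.smul_mem _ _ (Submodule.subset_span ⟨i, rfl⟩)
  · have : Set.EqOn (Dual.eval ℂ H (∑ i, a i • coroot (b i))) (Dual.eval ℂ H E)
        (Set.range fun i ↦ (b i).toLinear) := by
      rintro _ ⟨i, rfl⟩
      exact (ha i).trans (hb.apply_right i).symm
    exact LinearMap.eqOn_span this (hb.mem_span hα hαx)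

lemma finrank_corootSpan : finrank ℂ (corootSpan b) = Fintype.card ι :=
  finrank_span_eq_card <| (linearIndependent_coroot hb.isNonZero hb.linearIndependent).map'
    H.toSubmodule.subtype (Submodule.ker_subtype _)

lemma finrank_iSup_rootSp :
    finrank ℂ ↥(⨆ i, rootSp H (b i).toLinear) = Fintype.card ι := by
  choose e he he0 using fun i ↦ (Submodule.ne_bot_iff _).mp (hb.isRoot i).2
  have hspan : ⨆ i, rootSp H (b i).toLinear = Submodule.span ℂ (Set.range e) := by
    refine le_antisymm (iSup_le fun i y hy ↦ ?_) (Submodule.span_le.mpr ?_)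
    · obtain ⟨c, rfl⟩ := (hb.isRoot i).exists_eq_smul (he i) (he0 i) hy
      exact Submodule.smul_mem _ _ (Submodule.subset_span ⟨i, rfl⟩)
    · rintro _ ⟨i, rfl⟩
      exact Submodule.mem_iSup_of_mem i (he i)
  rw [hspan]
  exact finrank_span_eq_card <| iSupIndep.linearIndependent _
    ((iSupIndep_rootSp H).comp hb.linearIndependent.injective) he he0

/-- The roots of the Levi subalgebra on which `E` is positive have root spaces in every
Lie subalgebra containing the simple root spaces. -/
lemma rootSp_le_of_pos {K : LieSubalgebra ℂ L} (hK : ∀ i, rootSp H (b i).toLinear ≤ K.toSubmodule)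
    {n : ℕ} {α : Dual ℂ H} (hα : IsRoot H α) (hαx : α x = 0) (hn : α E = (n + 1 : ℕ)) :
    rootSp H α ≤ K.toSubmodule := by
  induction n generalizing α with
  | zero =>
    obtain ⟨i, rfl⟩ := hb.exists_eq_of_apply_eq_one hα hαx (by simpa using hn)
    exact hK i
  | succ n ih =>
    obtain ⟨c, hc, -⟩ := hb.exists_eq_of_pos hα hαx hn
    choose k hk using fun i ↦ (⟨_, apply_coroot_eq_cast hα.weight (b i)⟩ :
      ∃ k : ℤ, b i (coroot hα.weight) = k)
    have h2 : ∑ i, (c i : ℤ) * k i = 2 := by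
      have h := root_apply_coroot hα.isNonZero
      rw [hα.coe_weight, LinearMap.congr_fun hc] at h
      have : ∑ i, (c i : ℂ) * k i = 2 := by
        simpa [LinearMap.sum_apply, hk] using h
      exact_mod_cast this
    obtain ⟨i, -, hi⟩ : ∃ i ∈ Finset.univ, 0 < (c i : ℤ) * k i :=
      Finset.exists_lt_of_sum_lt (by simp [h2])
    have hki : 0 < k i := pos_of_mul_pos_right hi (by positivity)
    obtain ⟨m, hm, hm'⟩ := exists_pos_apply_coroot_comm hα.isNonZero (hb.isNonZero i) hki (hk i)
    obtain ⟨e, he, y, hy, hey, hey0⟩ :=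
      exists_lie_ne_zero_of_pairing_pos hα.weight (b i) (hb.isNonZero i) hm hm'
    rw [hα.toLinear_weight] at hy hey
    have hE : (α - (b i).toLinear) E = (n + 1 : ℕ) := by
      simp [hn, hb.apply_right]
    have hy0 : y ≠ 0 := by
      rintro rfl
      simp at hey0
    have hroot : IsRoot H (α - (b i).toLinear) := by
      refine ⟨fun h0 ↦ ?_, (Submodule.ne_bot_iff _).mpr ⟨y, hy, hy0⟩⟩
      rw [h0, LinearMap.zero_apply] at hE
      exact n.succ_ne_zero (by exact_mod_cast hE.symm)
    have hyK := ih hroot (by simp [hαx, hb.apply_left]) hE hy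
    intro z hz
    obtain ⟨c, rfl⟩ := hα.exists_eq_smul hey hey0 hz
    exact K.toSubmodule.smul_mem c (K.lie_mem (hK i he) hyK)

lemma corootSpan_le_adEig (Z : H) :
    corootSpan b ≤ adEig (commSpan (levi H x)) ((2 : ℂ) • (Z : L)) 0 := by
  refine fun v hv ↦ ⟨hb.commSpan_levi ▸ Submodule.mem_sup_left hv, ?_⟩
  have : corootSpan b ≤ H.toSubmodule := Submodule.span_le.mpr <| by
    rintro _ ⟨i, rfl⟩
    exact (coroot (b i)).2
  have hv0 : v ∈ rootSp H 0 := rootSp_zero H ▸ this hv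
  rw [smul_lie, hv0 Z]
  simp

lemma adEig_zero {Z : H} (hZ : ∀ α, IsRoot H α → α x = 0 → α Z = α E) :
    adEig (commSpan (levi H x)) ((2 : ℂ) • (Z : L)) 0 = corootSpan b := by
  refine le_antisymm ?_ (hb.corootSpan_le_adEig Z)
  rintro v ⟨hv, hv0⟩
  refine mem_left_of_mem_sup_of_mem_eigenspace (LieAlgebra.ad ℂ L ((2 : ℂ) • (Z : L))) 0 ?_ ?_
    (hb.commSpan_levi ▸ hv) (End.mem_eigenspace_iff.mpr (by simpa using hv0))
  · exact fun w hw ↦ End.mem_eigenspace_iff.mpr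
      (by simpa using (hb.corootSpan_le_adEig Z hw).2)
  · refine rootSum_le.mpr fun α ⟨hα, hαx⟩ ↦ ?_
    obtain ⟨k, hk0, hk⟩ := hb.exists_int hα hαx
    refine (rootSp_le_eigenspace α ((2 : ℂ) • Z)).trans
      (le_iSup₂_of_le (α ((2 : ℂ) • Z)) ?_ le_rfl)
    simpa [hZ α hα hαx, hk] using hk0

lemma adEig_two {Z : H} (hZ : ∀ α, IsRoot H α → α x = 0 → α Z = α E) :
    adEig (commSpan (levi H x)) ((2 : ℂ) • (Z : L)) 2 = ⨆ i, rootSp H (b i).toLinear := by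
  refine le_antisymm (adEig_le hZ two_ne_zero fun α hα hαx h ↦ ?_) (iSup_le fun i ↦ ?_)
  · obtain ⟨i, rfl⟩ := hb.exists_eq_of_apply_eq_one hα hαx (by simpa using h)
    exact le_iSup (fun i ↦ rootSp H (b i).toLinear) i
  · exact rootSp_le_adEig hZ (hb.isRoot i) (hb.apply_left i) (k := 1)
      (by simpa using hb.apply_right i)

theorem zDistinguished : ZDistinguished (levi H x) (E : L) := by
  obtain ⟨Z, hZb, hZ⟩ := hb.exists_mem_corootSpan
  have hZm : (Z : L) ∈ commSpan (levi H x) := hb.commSpan_levi ▸ Submodule.mem_sup_left hZb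
  refine ⟨Z, hZm, sub_mem_centerOf_levi hZ, Submodule.smul_mem _ _ hZm, ?_, ?_, ?_⟩
  · refine le_antisymm (iSup_le fun ℓ v hv ↦ hv.1) ?_
    conv_lhs => rw [hb.commSpan_levi]
    refine sup_le ((hb.corootSpan_le_adEig Z).trans (le_iSup_of_le 0 le_rfl))
      (rootSum_le.mpr fun α ⟨hα, hαx⟩ ↦ ?_)
    obtain ⟨k, -, hk⟩ := hb.exists_int hα hαx
    exact (rootSp_le_adEig hZ hα hαx hk).trans (le_iSup_of_le (2 * k) le_rfl)
  · rw [hb.adEig_zero hZ, hb.adEig_two hZ, hb.finrank_corootSpan, hb.finrank_iSup_rootSp]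
  · refine iSup₂_le fun ℓ hℓ ↦ adEig_le hZ hℓ.ne' fun α hα hαx h ↦ ?_
    obtain ⟨k, hk0, hk⟩ := hb.exists_int hα hαx
    have hk' : 2 * k = ℓ := by
      rw [hk] at h
      exact_mod_cast h
    obtain ⟨n, rfl⟩ := Int.eq_succ_of_zero_lt (show 0 < k by lia)
    refine hb.rootSp_le_of_pos (n := n) (fun i ↦ ?_) hα hαx (by exact_mod_cast hk)
    refine le_trans ?_ LieSubalgebra.subset_lieSpan
    rw [hb.adEig_two hZ]
    exact le_iSup (fun i ↦ rootSp H (b i).toLinear) i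

end IsSimpleFamily

end Simple

section Levi

variable {R S : Finset (Dual ℂ H)}

lemma sum_mem_span (S' : Finset (Dual ℂ H)) (c : Dual ℂ H → ℕ) :
    ∑ β ∈ S', c β • β ∈ Submodule.span ℤ (S' : Set (Dual ℂ H)) :=
  Submodule.sum_mem _ fun _ hβ ↦ Submodule.smul_of_tower_mem _ _ (Submodule.subset_span hβ)

lemma apply_eq_zero_of_mem_span {S' : Finset (Dual ℂ H)} {x : H} (h : ∀ β ∈ S', β x = 0)
    {α : Dual ℂ H} (hα : α ∈ Submodule.span ℤ (S' : Set (Dual ℂ H))) : α x = 0 := by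
  induction hα using Submodule.span_induction with
  | mem β hβ => exact h β hβ
  | zero => rfl
  | add _ _ _ _ h₁ h₂ => simp [h₁, h₂]
  | smul _ _ _ h => simp [h]

lemma apply_ne_zero_of_isSimpleSystemFor (hR : ∀ α, α ∈ R ↔ IsRoot H α)
    (hS : IsSimpleSystemFor H R ⊤ S) {E : H} (hES : ∀ β ∈ S, β E = 1) {α : Dual ℂ H}
    (hα : IsRoot H α) : α E ≠ 0 := by
  intro h0
  have key (c : Dual ℂ H → ℕ) (h : (∑ β ∈ S, c β • β) E = 0) : ∑ β ∈ S, c β • β = 0 := by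
    have : ∑ β ∈ S, c β = 0 := by
      rw [LinearMap.sum_apply, Finset.sum_congr rfl (g := fun β ↦ (c β : ℂ))
        fun β hβ ↦ by simp [hES β hβ]] at h
      exact_mod_cast h
    exact Finset.sum_eq_zero fun β hβ ↦ by rw [Finset.sum_eq_zero_iff.mp this β hβ, zero_smul]
  obtain ⟨c, rfl⟩ | ⟨c, rfl⟩ := hS.2.2 α ((hR α).mpr hα) le_top
  · exact hα.1 (key c h0)
  · exact hα.1 (neg_eq_zero.mpr (key c (by simpa using h0)))

variable [H.IsCartanSubalgebra]

lemma apply_eq_zero_of_isSimpleSystemFor {S' : Finset (Dual ℂ H)} {x : H}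
    (h : IsSimpleSystemFor H R (levi H x) S') (hR : ∀ α, α ∈ R ↔ IsRoot H α) {β : Dual ℂ H}
    (hβ : β ∈ S') : β x = 0 :=
  (rootSp_le_rootSum_iff ((hR β).mp (h.1 β hβ).1).2).mp (h.1 β hβ).2

/-- The simple roots of `g` vanishing at `x` are simple roots of the Levi subalgebra of `x`, as soon
as every root of the Levi subalgebra, up to sign, is a sum of such simple roots. -/
lemma isSimpleSystemFor_levi (hSR : S ⊆ R)
    (hS : LinearIndependent ℂ fun β : (S : Set (Dual ℂ H)) ↦ (β : Dual ℂ H)) {S' : Finset (Dual ℂ H)}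
    (hS' : S' ⊆ S) {x : H} (hx : ∀ β ∈ S', β x = 0) (hR : ∀ α, α ∈ R ↔ IsRoot H α)
    (h : ∀ α ∈ R, α x = 0 → (∃ c : Dual ℂ H → ℕ, α = ∑ β ∈ S', c β • β) ∨
      (∃ c : Dual ℂ H → ℕ, α = -∑ β ∈ S', c β • β)) :
    IsSimpleSystemFor H R (levi H x) S' :=
  ⟨fun β hβ ↦ ⟨hSR (hS' hβ), rootSp_le_rootSum (hx β hβ)⟩,
    LinearIndepOn.mono (v := id) hS (by exact_mod_cast hS'),
    fun α hα hαl ↦ h α hα ((rootSp_le_rootSum_iff ((hR α).mp hα).2).mp hαl)⟩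

variable [FiniteDimensional ℂ L]

/-- Every set of simple roots of `g` is a set of simple roots of a Levi subalgebra. -/
lemma exists_isSimpleSystemFor_levi (hR : ∀ α, α ∈ R ↔ IsRoot H α) (hSR : S ⊆ R)
    (hS : IsSimpleSystemFor H R ⊤ S) {S' : Finset (Dual ℂ H)} (hS' : S' ⊆ S) :
    ∃ x : H, IsSimpleSystemFor H R (levi H x) S' := by
  classical
  obtain ⟨x, hx⟩ := exists_apply_eq hS.2.1 fun β ↦ if β ∈ S' then 0 else 1
  refine ⟨x, isSimpleSystemFor_levi hSR hS.2.1 hS' (fun β hβ ↦ by simp [hx β (hS' hβ), hβ]) hR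
    fun α hα hαx ↦ ?_⟩
  have key (c : Dual ℂ H → ℕ) (h : (∑ β ∈ S, c β • β) x = 0) :
      ∑ β ∈ S, c β • β = ∑ β ∈ S', c β • β := by
    have : ∑ β ∈ S, (if β ∈ S' then 0 else c β) = 0 := by
      rw [LinearMap.sum_apply, Finset.sum_congr rfl
        (g := fun β ↦ ((if β ∈ S' then 0 else c β : ℕ) : ℂ))
        fun β hβ ↦ by rw [LinearMap.smul_apply, hx β hβ]; split <;> simp] at h
      exact_mod_cast h
    refine (Finset.sum_subset hS' fun β hβ hβ' ↦ ?_).symm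
    have := Finset.sum_eq_zero_iff.mp this β hβ
    rw [if_neg hβ'] at this
    rw [this, zero_smul]
  obtain ⟨c, rfl⟩ | ⟨c, rfl⟩ := hS.2.2 α hα le_top
  · exact Or.inl ⟨c, key c hαx⟩
  · exact Or.inr ⟨c, by rw [key c (by simpa using hαx)]⟩

variable [IsKilling ℂ L]

lemma mem_iff_isRoot (hR0 : (0 : Dual ℂ H) ∉ R) (hRne : ∀ α ∈ R, rootSp H α ≠ ⊥)
    (hsup : H.toSubmodule ⊔ (⨆ α ∈ R, rootSp H α) = ⊤) (α : Dual ℂ H) : α ∈ R ↔ IsRoot H α := by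
  refine ⟨fun h ↦ ⟨fun h0 ↦ hR0 (h0 ▸ h), hRne α h⟩, fun h ↦ ?_⟩
  have htop : (⊤ : Submodule ℂ L) ≤ rootSum H (fun χ ↦ χ = 0 ∨ χ ∈ R) := by
    rw [← hsup, ← rootSp_zero H]
    exact sup_le (rootSp_le_rootSum (Or.inl rfl))
      (iSup₂_le fun χ hχ ↦ rootSp_le_rootSum (P := fun χ ↦ χ = 0 ∨ χ ∈ R) (Or.inr hχ))
  exact ((rootSp_le_rootSum_iff h.2).mp (le_top.trans htop)).resolve_left h.1

lemma sup_eq_rootSum (hR : ∀ α, α ∈ R ↔ IsRoot H α) {P : Dual ℂ H → Prop} (h0 : P 0) :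
    H.toSubmodule ⊔ ⨆ α ∈ R, ⨆ _ : P α, rootSp H α = rootSum H P := by
  rw [← rootSp_zero H]
  refine le_antisymm (sup_le (rootSp_le_rootSum h0)
    (iSup₂_le fun χ _ ↦ iSup_le fun hχ ↦ rootSp_le_rootSum hχ)) (rootSum_le.mpr fun χ hχ ↦ ?_)
  by_cases hχ0 : χ = 0
  · exact hχ0 ▸ le_sup_left
  by_cases hbot : rootSp H χ = ⊥
  · simp [hbot]
  · exact le_sup_of_le_right (le_iSup₂_of_le χ ((hR χ).mpr ⟨hχ0, hbot⟩) (le_iSup_of_le hχ le_rfl))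

lemma isLeviOf_iff (hR : ∀ α, α ∈ R ↔ IsRoot H α) {l : Submodule ℂ L} :
    IsLeviOf H R l ↔ ∃ x : H, l = levi H x :=
  exists_congr fun x ↦ by rw [sup_eq_rootSum hR (P := fun α ↦ α x = 0) rfl, levi]

lemma leviOf_eq_rootSum (hR : ∀ α, α ∈ R ↔ IsRoot H α) (S' : Finset (Dual ℂ H)) :
    leviOf H R S' = rootSum H (· ∈ Submodule.span ℤ (S' : Set (Dual ℂ H))) :=
  sup_eq_rootSum hR (zero_mem _)

lemma leviOf_eq_levi (hR : ∀ α, α ∈ R ↔ IsRoot H α) {S' : Finset (Dual ℂ H)} {x : H}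
    (h : IsSimpleSystemFor H R (levi H x) S') : leviOf H R S' = levi H x := by
  rw [leviOf_eq_rootSum hR]
  refine le_antisymm (rootSum_mono fun χ _ hχ ↦
    apply_eq_zero_of_mem_span (fun β hβ ↦ apply_eq_zero_of_isSimpleSystemFor h hR hβ) hχ)
    (rootSum_mono fun χ hbot hχ ↦ ?_)
  by_cases hχ0 : χ = 0
  · exact hχ0 ▸ zero_mem _
  obtain ⟨c, rfl⟩ | ⟨c, rfl⟩ := h.2.2 χ ((hR χ).mpr ⟨hχ0, hbot⟩) (rootSp_le_rootSum hχ)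
  · exact sum_mem_span S' c
  · exact neg_mem (sum_mem_span S' c)

lemma zDistinguished_of_isSimpleSystemFor (hR : ∀ α, α ∈ R ↔ IsRoot H α) {S' : Finset (Dual ℂ H)}
    {x E : H} (h : IsSimpleSystemFor H R (levi H x) S') (hE : ∀ β ∈ S', β E = 1) :
    ZDistinguished (levi H x) (E : L) := by
  have hroot (β : S') : IsRoot H β := (hR β).mp (h.1 β β.2).1
  refine IsSimpleFamily.zDistinguished (b := fun β : S' ↦ (hroot β).weight)
    ⟨fun β ↦ (hroot β).isNonZero, h.2.1, fun β ↦ apply_eq_zero_of_isSimpleSystemFor h hR β.2,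
      fun β ↦ hE β β.2, fun α hα hαx ↦ ?_⟩
  have hsum (c : Dual ℂ H → ℕ) :
      ∑ β : S', c β • (hroot β).weight.toLinear = ∑ β ∈ S', c β • β :=
    Finset.sum_coe_sort S' fun β ↦ c β • β
  obtain ⟨c, hc⟩ | ⟨c, hc⟩ := h.2.2 α ((hR α).mpr hα) (rootSp_le_rootSum hαx)
  · exact ⟨fun β ↦ c β, Or.inl (by rw [hsum, hc])⟩
  · exact ⟨fun β ↦ c β, Or.inr (by rw [hsum, hc])⟩

lemma exists_isSimpleSystemFor_of_zDistinguished (hR : ∀ α, α ∈ R ↔ IsRoot H α) (hSR : S ⊆ R)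
    (hS : IsSimpleSystemFor H R ⊤ S) {x E : H} (hES : ∀ β ∈ S, β E = 1)
    (hEchar : ∀ α ∈ R, α E = 1 → α ∈ S) (hEint : ∀ α ∈ R, ∃ m : ℤ, α E = m)
    (h : ZDistinguished (levi H x) (E : L)) :
    ∃ S' ⊆ S, IsSimpleSystemFor H R (levi H x) S' := by
  classical
  have hpos {α : Dual ℂ H} (hα : IsRoot H α) (hαx : α x = 0) {k : ℤ} (hk : 0 < k)
      (hαE : α E = k) : ∃ c : Dual ℂ H → ℕ, α = ∑ β ∈ S with β x = 0, c β • β := by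
    have := mem_closure_of_zDistinguished (S := S)
      (fun α hα hαE ↦ hEchar α ((hR α).mpr hα) hαE) h hα hαx hk hαE
    rw [show {β ∈ (S : Set (Dual ℂ H)) | β x = 0} = ↑({β ∈ S | β x = 0} : Finset (Dual ℂ H)) by
      simp] at this
    obtain ⟨c, -, hc⟩ := AddSubmonoid.mem_closure_finset.mp this
    exact ⟨c, hc.symm⟩
  refine ⟨S.filter (fun β ↦ β x = 0), Finset.filter_subset _ _, isSimpleSystemFor_levi hSR hS.2.1
    (Finset.filter_subset _ _) (fun β hβ ↦ (Finset.mem_filter.mp hβ).2) hR fun α hα hαx ↦ ?_⟩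
  have hα' := (hR α).mp hα
  obtain ⟨k, hk⟩ := hEint α hα
  have hk0 : k ≠ 0 := by
    rintro rfl
    exact apply_ne_zero_of_isSimpleSystemFor hR hS hES hα' (by simpa using hk)
  obtain hk0 | hk0 := hk0.lt_or_gt
  · obtain ⟨c, hc⟩ := hpos hα'.neg (by simp [hαx]) (k := -k) (by lia) (by simp [hk])
    exact Or.inr ⟨c, by rw [← hc, neg_neg]⟩
  · exact Or.inl (hpos hα' hαx hk0 hk)

end Levi

end LeviSimple

/-- **Levi subalgebras with distinguished `2π^ss(E)` correspond to subsets of the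
simple roots.**  Let `g` be a complex semisimple Lie algebra with Cartan subalgebra
`h = H`, root system `R`, root spaces `g^α`, fixed simple roots `S ⊆ R`, and let
`E ∈ h` be the grading element with `α(E) = 1` for all `α ∈ S` (so that a root `α`
satisfies `α(E) = 1` iff `α ∈ S`).  Then for every Levi subalgebra `l ⊇ h`,
`Z := 2·π^ss(E)` is a distinguished grading element of `l^ss` iff `l^ss` admits a set
of simple roots contained in `S`; and `S' ↦ h ⊕ ⊕_{α ∈ R ∩ span_ℤ S'} g^α` is a
bijection from the power set of `S` onto the Levi subalgebras `l ⊇ h` for which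
`2·π^ss(E)` is a distinguished grading element of `l^ss`. -/
theorem stmt7 {L : Type*} [LieRing L] [LieAlgebra ℂ L] [FiniteDimensional ℂ L]
    [LieAlgebra.IsSemisimple ℂ L]
    (H : LieSubalgebra ℂ L) [H.IsCartanSubalgebra]
    (R : Finset (Module.Dual ℂ H)) (hR0 : (0 : Module.Dual ℂ H) ∉ R)
    (hRne : ∀ α ∈ R, rootSp H α ≠ ⊥)
    (hindep : iSupIndep (fun o : Option {α // α ∈ R} =>
        o.elim H.toSubmodule (fun α => rootSp H (α : Module.Dual ℂ H))))
    (hsup : H.toSubmodule ⊔ (⨆ α ∈ R, rootSp H α) = ⊤)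
    (S : Finset (Module.Dual ℂ H)) (hSR : S ⊆ R)
    (hSsimple : IsSimpleSystemFor H R ⊤ S)
    (E : H)
    (hES : ∀ α ∈ S, α E = 1)
    (hEchar : ∀ α ∈ R, α E = 1 → α ∈ S)
    (hEint : ∀ α ∈ R, ∃ m : ℤ, α E = (m : ℂ)) :
    (∀ l : Submodule ℂ L, IsLeviOf H R l →
        (ZDistinguished l (E : L) ↔ ∃ S' ⊆ S, IsSimpleSystemFor H R l S')) ∧
    (∀ S' ⊆ S, IsLeviOf H R (leviOf H R S') ∧ ZDistinguished (leviOf H R S') (E : L)) ∧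
    (∀ S'₁ ⊆ S, ∀ S'₂ ⊆ S, leviOf H R S'₁ = leviOf H R S'₂ → S'₁ = S'₂) ∧
    (∀ l : Submodule ℂ L, IsLeviOf H R l → ZDistinguished l (E : L) →
        ∃ S' ⊆ S, leviOf H R S' = l) := by
  open LeviSimple in
  have hR := mem_iff_isRoot hR0 hRne hsup
  have hdist (S' : Finset (Module.Dual ℂ H)) (hS' : S' ⊆ S) : ∃ x : H,
      leviOf H R S' = levi H x ∧ ZDistinguished (leviOf H R S') (E : L) := by
    obtain ⟨x, hx⟩ := exists_isSimpleSystemFor_levi hR hSR hSsimple hS'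
    refine ⟨x, leviOf_eq_levi hR hx, ?_⟩
    rw [leviOf_eq_levi hR hx]
    exact zDistinguished_of_isSimpleSystemFor hR hx fun β hβ ↦ hES β (hS' hβ)
  have hiff (x : H) : ZDistinguished (levi H x) (E : L) ↔
      ∃ S' ⊆ S, IsSimpleSystemFor H R (levi H x) S' :=
    ⟨exists_isSimpleSystemFor_of_zDistinguished hR hSR hSsimple hES hEchar hEint,
      fun ⟨_, hS', h⟩ ↦ zDistinguished_of_isSimpleSystemFor hR h fun β hβ ↦ hES β (hS' hβ)⟩
  refine ⟨fun l hl ↦ ?_, fun S' hS' ↦ ?_, fun S₁ h₁ S₂ h₂ h ↦ ?_, fun l hl hZ ↦ ?_⟩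
  · obtain ⟨x, rfl⟩ := (isLeviOf_iff hR).mp hl
    exact hiff x
  · obtain ⟨x, hx, hZ⟩ := hdist S' hS'
    exact ⟨(isLeviOf_iff hR).mpr ⟨x, hx⟩, hZ⟩
  · have key {A B : Finset (Module.Dual ℂ H)} (hA : A ⊆ S) (hB : B ⊆ S)
        (hAB : leviOf H R A = leviOf H R B) : A ⊆ B := by
      intro β hβ
      rw [leviOf_eq_rootSum hR, leviOf_eq_rootSum hR] at hAB
      refine mem_of_mem_span_int hSsimple.2.1 hB (hA hβ) ?_
      refine (rootSp_le_rootSum_iff (hRne β (hSR (hA hβ)))).mp ?_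
      exact hAB ▸ rootSp_le_rootSum
        (P := (· ∈ Submodule.span ℤ (A : Set (Module.Dual ℂ H)))) (Submodule.subset_span hβ)
    exact (key h₁ h₂ h).antisymm (key h₂ h₁ h.symm)
  · obtain ⟨x, rfl⟩ := (isLeviOf_iff hR).mp hl
    obtain ⟨S', hS', h⟩ := (hiff x).mp hZ
    exact ⟨S', hS', leviOf_eq_levi hR h⟩
end

section
/- Let g be a finite-dimensional complex semisimple Lie algebra with Cartan subalgebra h, root system R, simple roots S, and let E ∈ h be the grading element with α(E) = 1 for every α ∈ S (so that a root α satisfies α(E) = 1 if and only if α is simple). Let l ⊇ h be a Levi subalgebra such that Z := 2·π^ss(E) is a distinguished grading element of the semisimple factor l^ss. Then l equals the centralizer of 2E − Z in g, i.e. l = { ξ ∈ g : [2E − Z, ξ] = 0 }. -/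
open Module LieAlgebra LieAlgebra.IsKilling

/-- A linear system with positive right-hand side whose matrix is positive semidefinite with
nonpositive off-diagonal entries has only nonnegative solutions. -/
theorem nonneg_of_forall_sum_pos_of_offDiag_nonpos {ι : Type*} [Fintype ι] (A : ι → ι → ℝ)
    (hpsd : ∀ v : ι → ℝ, 0 ≤ ∑ i, ∑ j, v i * A i j * v j)
    (hoff : ∀ i j, i ≠ j → A i j ≤ 0) (a : ι → ℝ) (ha : ∀ i, 0 < ∑ j, A i j * a j) (i : ι) :
    0 ≤ a i := by
  by_contra! hi
  have hle : ∑ i, ∑ j, (a i)⁻ * A i j * (a j)⁻ ≤ -∑ i, (a i)⁻ * ∑ j, A i j * a j := by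
    rw [← Finset.sum_neg_distrib]
    refine Finset.sum_le_sum fun i _ => ?_
    rw [Finset.mul_sum, ← Finset.sum_neg_distrib]
    refine Finset.sum_le_sum fun j _ => ?_
    have hj : a j = (a j)⁺ - (a j)⁻ := (posPart_sub_negPart (a j)).symm
    have h : (a i)⁻ * A i j * (a j)⁺ ≤ 0 := by
      by_cases hij : i = j
      · subst hij
        have h0 : (a i)⁺ * (a i)⁻ = 0 := by
          rcases le_total 0 (a i) with h | h
          · simp [negPart_eq_zero.2 h]
          · simp [posPart_eq_zero.2 h]
        linear_combination A i i * h0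
      · exact mul_nonpos_of_nonpos_of_nonneg
          (mul_nonpos_of_nonneg_of_nonpos (negPart_nonneg _) (hoff i j hij)) (posPart_nonneg _)
    calc (a i)⁻ * A i j * (a j)⁻
        = (a i)⁻ * A i j * (a j)⁺ - (a i)⁻ * (A i j * ((a j)⁺ - (a j)⁻)) := by ring
      _ ≤ -((a i)⁻ * (A i j * a j)) := by rw [← hj]; linarith
  have hpos : 0 < ∑ i, (a i)⁻ * ∑ j, A i j * a j :=
    Finset.sum_pos' (fun j _ => mul_nonneg (negPart_nonneg _) (ha j).le)
      ⟨i, Finset.mem_univ _, mul_pos (negPart_pos hi) (ha i)⟩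
  linarith [hpsd fun i => (a i)⁻]

/-- If the pairings of a combination of pairwise obtuse coroots with the corresponding roots have
positive real part, then all its coefficients have nonnegative real part. -/
theorem RootPairing.re_nonneg_of_forall_re_sum_pairing_pos {ι M N : Type*} [Finite ι]
    [AddCommGroup M] [Module ℂ M] [AddCommGroup N] [Module ℂ N] (P : RootPairing ι ℂ M N)
    [P.IsCrystallographic] {s : Type*} [Fintype s] (f : s → ι)
    (hoff : ∀ i j, i ≠ j → P.pairingIn ℤ (f i) (f j) ≤ 0) (c : s → ℂ)
    (hc : ∀ i, 0 < (∑ j, c j * P.pairing (f i) (f j)).re) (i : s) : 0 ≤ (c i).re := by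
  have := Fintype.ofFinite ι
  have hpair (i j) : P.pairing i j = (P.pairingIn ℤ i j : ℂ) := by
    simp [← P.algebraMap_pairingIn ℤ]
  set A : ι → ι → ℤ := fun i j => ∑ k, P.pairingIn ℤ k i * P.pairingIn ℤ k j
  have hA (i j) : A i i * P.pairingIn ℤ i j = 2 * A i j := by
    have h := congrArg (fun m => P.toLinearMap m (P.coroot j)) (P.corootForm_self_smul_root i)
    simp only [map_smul, LinearMap.smul_apply, map_nsmul,
      RootPairing.toLinearMap_apply_CoPolarization, RootPairing.corootForm_apply_apply,
      RootPairing.root'_coroot_eq_pairing, hpair,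
      smul_eq_mul, nsmul_eq_mul] at h
    exact_mod_cast h
  have hdiag (i) : 0 < A i i :=
    Finset.sum_pos' (fun k _ => mul_self_nonneg _) ⟨i, Finset.mem_univ _, by simp⟩
  refine nonneg_of_forall_sum_pos_of_offDiag_nonpos (fun i j => (A (f i) (f j) : ℝ))
    (fun v => ?_) (fun i j hij => ?_) (fun i => (c i).re) (fun i => ?_) i
  · have : ∑ i, ∑ j, v i * A (f i) (f j) * v j
        = ∑ k, (∑ i, v i * P.pairingIn ℤ k (f i)) ^ 2 := by
      simp only [A, sq, Finset.sum_mul_sum]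
      push_cast
      simp only [Finset.mul_sum, Finset.sum_mul]
      rw [Finset.sum_comm' (t' := Finset.univ) (s' := fun _ => Finset.univ) (by simp)]
      rw [Finset.sum_comm]
      conv_rhs => rw [Finset.sum_comm]
      refine Finset.sum_congr rfl fun i _ => ?_
      conv_rhs => rw [Finset.sum_comm]
      refine Finset.sum_congr rfl fun j _ => Finset.sum_congr rfl fun k _ => ?_
      ring
    rw [this]
    positivity
  · have h := hA (f i) (f j)
    have := mul_nonpos_of_nonneg_of_nonpos (hdiag (f i)).le (hoff i j hij)
    exact_mod_cast (by omega : A (f i) (f j) ≤ 0)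
  · have h : (2 : ℝ) * ∑ j, (A (f i) (f j) : ℝ) * (c j).re
        = A (f i) (f i) * (∑ j, c j * P.pairing (f i) (f j)).re := by
      rw [Complex.re_sum, Finset.mul_sum, Finset.mul_sum]
      refine Finset.sum_congr rfl fun j _ => ?_
      have hA' : (A (f i) (f i) : ℝ) * P.pairingIn ℤ (f i) (f j) = 2 * A (f i) (f j) := by
        exact_mod_cast hA (f i) (f j)
      rw [hpair, show (c j * (P.pairingIn ℤ (f i) (f j) : ℂ)).re
        = (c j).re * P.pairingIn ℤ (f i) (f j) by simp]
      linear_combination -(c j).re * hA'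
    have := mul_pos (Int.cast_pos (R := ℝ).2 (hdiag (f i))) (hc i)
    linarith

section

variable {L : Type*} [LieRing L] [LieAlgebra ℂ L] {H : LieSubalgebra ℂ L}

theorem mem_biSup_rootSp_of_lie_eq_smul {F : Set (Dual ℂ H)} {h : H} {ν : ℂ} {w : L}
    (hw : w ∈ ⨆ α ∈ F, rootSp H α) (hν : ⁅(h : L), w⁆ = ν • w) :
    w ∈ ⨆ α ∈ {α ∈ F | α h = ν}, rootSp H α := by
  set U := ⨆ α ∈ {α ∈ F | α h = ν}, rootSp H α
  set φ : Module.End ℂ L := LieAlgebra.ad ℂ L (h : L)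
  have hle (α : Dual ℂ H) : rootSp H α ≤ φ.eigenspace (α h) :=
    fun x hx => Module.End.mem_eigenspace_iff.2 (hx h)
  have hU : U ≤ φ.eigenspace ν := iSup₂_le fun α hα => by simpa [hα.2] using hle α
  have hF : ⨆ α ∈ F, rootSp H α ≤ U ⊔ ⨆ μ ≠ ν, φ.eigenspace μ := by
    refine iSup₂_le fun α hα => ?_
    by_cases hαν : α h = ν
    · exact le_sup_of_le_left (le_iSup₂_of_le α ⟨hα, hαν⟩ le_rfl)
    · exact le_sup_of_le_right ((hle α).trans (le_iSup₂_of_le (α h) hαν le_rfl))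
  obtain ⟨u, hu, v, hv, rfl⟩ := Submodule.mem_sup.1 (hF hw)
  have huv : u + v ∈ φ.eigenspace ν := Module.End.mem_eigenspace_iff.2 hν
  have hv' : v ∈ φ.eigenspace ν := by simpa using sub_mem huv (hU hu)
  rw [Submodule.disjoint_def.1 (φ.eigenspaces_iSupIndep ν) v hv' hv, add_zero]
  exact hu

theorem lie_eq_smul_of_mem_biSup_rootSp {F : Set (Dual ℂ H)} {h : H} {ν : ℂ}
    (hF : ∀ α ∈ F, α h = ν) {w : L} (hw : w ∈ ⨆ α ∈ F, rootSp H α) :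
    ⁅(h : L), w⁆ = ν • w := by
  have : ⨆ α ∈ F, rootSp H α ≤ Module.End.eigenspace (LieAlgebra.ad ℂ L (h : L)) ν :=
    iSup₂_le fun α hα x hx => Module.End.mem_eigenspace_iff.2 (by simpa [hF α hα] using hx h)
  simpa using Module.End.mem_eigenspace_iff.1 (this hw)

theorem mem_of_forall_lie_eq_zero [H.IsCartanSubalgebra] {x : L}
    (hx : ∀ h : H, ⁅x, (h : L)⁆ = 0) : x ∈ H := by
  rw [← LieSubalgebra.IsCartanSubalgebra.self_normalizing (H := H),
    LieSubalgebra.mem_normalizer_iff]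
  intro y hy
  rw [hx ⟨y, hy⟩]
  exact H.zero_mem

variable [H.IsCartanSubalgebra]

theorem rootSp_le_rootSpace (α : Dual ℂ H) : rootSp H α ≤ (rootSpace H α).toSubmodule := by
  intro x hx
  refine LieModule.weightSpace_le_genWeightSpace L α ?_
  rw [LieModule.mem_weightSpace]
  exact hx

variable [FiniteDimensional ℂ L] [IsKilling ℂ L]

theorem rootSp_zero_eq : rootSp H 0 = H.toSubmodule := by
  refine le_antisymm (fun x hx => ?_) fun x hx h => ?_
  · refine mem_of_forall_lie_eq_zero fun h => ?_
    rw [← lie_skew, hx h]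
    simp
  · have := congrArg (Subtype.val) (trivial_lie_zero H H h ⟨x, hx⟩)
    simpa using this

theorem exists_root_eq_of_rootSp_ne_bot {α : Dual ℂ H} (hα : rootSp H α ≠ ⊥) (h0 : α ≠ 0) :
    ∃ i, (rootSystem H).root i = α := by
  let χ : LieModule.Weight ℂ H L := ⟨α, fun h => hα <| by
    rw [eq_bot_iff]
    simpa [h] using rootSp_le_rootSpace α⟩
  have hχ : χ.IsNonZero := fun h => h0 (LinearMap.ext fun y => congrFun h y)
  exact ⟨⟨χ, by simpa using hχ⟩, rfl⟩

theorem root_mem_of_sup_rootSp_eq_top {R : Finset (Dual ℂ H)}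
    (hsup : H.toSubmodule ⊔ (⨆ α ∈ R, rootSp H α) = ⊤) (i : H.root) :
    (rootSystem H).root i ∈ R := by
  by_contra hi
  set α := (rootSystem H).root i
  have hα : (α : H → ℂ) ≠ 0 := H.isNonZero_coe_root i
  have hind := LieModule.iSupIndep_genWeightSpace ℂ H L
  rw [← LieSubmodule.iSupIndep_toSubmodule] at hind
  have htop : (⊤ : Submodule ℂ L) ≤ ⨆ χ ≠ (α : H → ℂ), (rootSpace H χ).toSubmodule := by
    rw [← hsup, ← rootSp_zero_eq]
    refine sup_le ?_ (iSup₂_le fun β hβ => ?_)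
    · exact (rootSp_le_rootSpace 0).trans (le_iSup₂_of_le (0 : H → ℂ) hα.symm le_rfl)
    · refine (rootSp_le_rootSpace β).trans (le_iSup₂_of_le (β : H → ℂ) (fun h => hi ?_) le_rfl)
      rwa [← DFunLike.coe_injective h]
  have hbot := (hind (α : H → ℂ)).mono_right htop
  rw [disjoint_top, LieSubmodule.toSubmodule_eq_bot] at hbot
  exact i.1.genWeightSpace_ne_bot' hbot

theorem mem_span_coroot_of_forall_killingForm_eq_zero {s : Type*} [Finite s] (f : s → H.root)
    (e : H) (he : ∀ y : H, (∀ i, (rootSystem H).root (f i) y = 0) → killingForm ℂ L e y = 0) :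
    e ∈ Submodule.span ℂ (Set.range fun i => (rootSystem H).coroot (f i)) := by
  have hspan : cartanEquivDual H e ∈
      Submodule.span ℂ (Set.range fun i => (rootSystem H).root (f i)) :=
    mem_span_of_iInf_ker_le_ker fun y hy =>
      he y fun i => by simpa using (Submodule.mem_iInf _).1 hy i
  rw [← (cartanEquivDual H).symm_apply_apply e]
  refine Submodule.span_le.2 ?_ (Submodule.apply_mem_span_image_of_mem_span
    (cartanEquivDual H).symm.toLinearMap hspan)
  rintro _ ⟨_, ⟨i, rfl⟩, rfl⟩
  have hne := root_apply_cartanEquivDual_symm_ne_zero (H.isNonZero_coe_root (f i))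
  have hcoroot : (cartanEquivDual H).symm ((rootSystem H).root (f i)) =
      (((f i : LieModule.Weight ℂ H L) ((cartanEquivDual H).symm (f i).1)) / 2) •
        (rootSystem H).coroot (f i) := by
    rw [rootSystem_coroot_apply, coroot, ← Nat.cast_smul_eq_nsmul ℂ, smul_smul, smul_smul,
      Nat.cast_ofNat, div_mul_cancel₀ _ two_ne_zero, mul_inv_cancel₀ hne, one_smul,
      rootSystem_root_apply]
  simp only [LinearEquiv.coe_coe, SetLike.mem_coe, hcoroot]
  exact Submodule.smul_mem _ _ (Submodule.subset_span ⟨i, rfl⟩)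

theorem mem_biSup_rootSp_insert_zero {R : Finset (Dual ℂ H)}
    (hsup : H.toSubmodule ⊔ (⨆ α ∈ R, rootSp H α) = ⊤) (w : L) :
    w ∈ ⨆ α ∈ (insert 0 (R : Set (Dual ℂ H))), rootSp H α := by
  have htop : ⨆ α ∈ (insert 0 (R : Set (Dual ℂ H))), rootSp H α = ⊤ := by
    rw [iSup_insert, rootSp_zero_eq]
    exact hsup
  exact htop ▸ Submodule.mem_top

theorem IsLeviOf.exists_mem_iff {R : Finset (Dual ℂ H)}
    (hsup : H.toSubmodule ⊔ (⨆ α ∈ R, rootSp H α) = ⊤) {l : Submodule ℂ L}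
    (hl : IsLeviOf H R l) :
    ∃ x : H, (∀ w, w ∈ l ↔ ⁅(x : L), w⁆ = 0) ∧ ∀ α : Dual ℂ H, α x = 0 → rootSp H α ≤ l := by
  obtain ⟨x, rfl⟩ := hl
  have hmem (w : L) : w ∈ H.toSubmodule ⊔ ⨆ α ∈ R, ⨆ _ : α x = 0, rootSp H α ↔
      ⁅(x : L), w⁆ = 0 := by
    constructor
    · intro hw
      rw [← zero_smul ℂ w]
      refine lie_eq_smul_of_mem_biSup_rootSp (F := {α | α x = 0}) (fun α hα => hα) ?_
      refine (sup_le ?_ (iSup₂_le fun α _ => iSup_le fun hα => ?_) :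
        H.toSubmodule ⊔ ⨆ α ∈ R, ⨆ _ : α x = 0, rootSp H α ≤
          ⨆ α ∈ {α : Dual ℂ H | α x = 0}, rootSp H α) hw
      · rw [← rootSp_zero_eq]
        exact le_iSup₂_of_le (0 : Dual ℂ H) rfl le_rfl
      · exact le_iSup₂_of_le α hα le_rfl
    · intro hw
      have h := mem_biSup_rootSp_of_lie_eq_smul (ν := 0)
        (mem_biSup_rootSp_insert_zero hsup w) (by rw [hw, zero_smul])
      refine (iSup₂_le ?_ : ⨆ α ∈ {α ∈ insert 0 (R : Set (Dual ℂ H)) | α x = 0}, rootSp H α ≤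
        _) h
      rintro α ⟨rfl | hα, hαx⟩
      · exact rootSp_zero_eq.le.trans le_sup_left
      · exact le_sup_of_le_right (le_iSup₂_of_le α hα (le_iSup_of_le hαx le_rfl))
  exact ⟨x, hmem, fun α hα w hw => (hmem w).2 (by rw [hw x, hα, zero_smul])⟩

/-- An element of `H` killed by the simple roots of `l` commutes with the positive root spaces
of `l`, since these lie in the subalgebra generated by the degree-two part of `[l, l]`. -/
theorem IsDistinguishedOn.lie_eq_zero_of_forall_simple {R S : Finset (Dual ℂ H)}
    (hsup : H.toSubmodule ⊔ (⨆ α ∈ R, rootSp H α) = ⊤) {E e x y : H}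
    (hEchar : ∀ α ∈ R, α E = 1 → α ∈ S) {l : Submodule ℂ L}
    (hl : ∀ w, w ∈ l ↔ ⁅(x : L), w⁆ = 0) (he : ∀ w ∈ l, ⁅(e : L), w⁆ = ⁅(E : L), w⁆)
    (hdist : IsDistinguishedOn (commSpan l) ((2 : ℂ) • (e : L)))
    (hy : ∀ γ ∈ S, γ x = 0 → γ y = 0) {α : Dual ℂ H} (hαx : α x = 0) {n : ℕ} (hn : 0 < n)
    (hαE : α E = n) {z : L} (hz : z ∈ rootSp H α) : ⁅(y : L), z⁆ = 0 := by
  have hzl : z ∈ l := (hl z).2 (by rw [hz x, hαx, zero_smul])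
  have hEl : (E : L) ∈ l := (hl E).2 (congrArg Subtype.val (trivial_lie_zero H H x E))
  have hn0 : (n : ℂ) ≠ 0 := by exact_mod_cast hn.ne'
  have hzc : z ∈ commSpan l := by
    rw [← inv_smul_smul₀ hn0 z, ← hαE, ← hz E]
    exact Submodule.smul_mem _ _ (Submodule.subset_span ⟨E, hEl, z, hzl, rfl⟩)
  have hzeig : z ∈ adEig (commSpan l) ((2 : ℂ) • (e : L)) (2 * n) := by
    refine ⟨hzc, ?_⟩
    rw [smul_lie, he z hzl, hz E, hαE, smul_smul]
    push_cast
    rfl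
  have hzspan : z ∈ LieSubalgebra.lieSpan ℂ L (adEig (commSpan l) ((2 : ℂ) • (e : L)) 2 : Set L) :=
    hdist.2.2.2 ((le_iSup₂_of_le (f := fun (ℓ : ℤ) (_ : 0 < ℓ) =>
      adEig (commSpan l) ((2 : ℂ) • (e : L)) ℓ) (2 * n : ℤ) (by omega) le_rfl) hzeig)
  have hcl : commSpan l ≤ l := by
    refine Submodule.span_le.2 ?_
    rintro _ ⟨u, hu, v, hv, rfl⟩
    refine (hl _).2 ?_
    rw [leibniz_lie, (hl u).1 hu, (hl v).1 hv, zero_lie, lie_zero, add_zero]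
  clear hz hzl hzc hzeig
  induction hzspan using LieSubalgebra.lieSpan_induction with
  | mem w hw =>
    obtain ⟨hwc, hw2⟩ := hw
    have hwl := hcl hwc
    rw [smul_lie, he w hwl, Int.cast_ofNat] at hw2
    have hwE := smul_right_injective L (two_ne_zero (α := ℂ)) hw2
    have hwR := mem_biSup_rootSp_of_lie_eq_smul (h := E) (ν := 1)
      (mem_biSup_rootSp_insert_zero hsup w) (by rw [one_smul, hwE])
    have hwx := mem_biSup_rootSp_of_lie_eq_smul (h := x) (ν := 0) hwR
      (by rw [zero_smul, (hl w).1 hwl])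
    rw [← zero_smul ℂ w]
    refine lie_eq_smul_of_mem_biSup_rootSp ?_ hwx
    rintro β ⟨⟨rfl | hβ, hβE⟩, hβx⟩
    · rfl
    · exact hy β (hEchar β hβ hβE) hβx
  | zero => exact lie_zero _
  | add u v _ _ hu hv => rw [lie_add, hu, hv, add_zero]
  | smul c u _ hu => rw [lie_smul, hu, smul_zero]
  | lie u v _ _ hu hv => rw [leibniz_lie, hu, hv, zero_lie, lie_zero, add_zero]

end

/-- **The diagonal Levi is the centralizer of `2E − Z`.**  Let `g` be a complex
semisimple Lie algebra with Cartan subalgebra `h = H`, root system `R`, simple roots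
`S`, and let `E ∈ h` be the grading element with `α(E) = 1` for every `α ∈ S` (so that
a root `α` satisfies `α(E) = 1` iff `α ∈ S`).  Let `l ⊇ h` be a Levi subalgebra such
that `Z := 2·π^ss(E)` is a distinguished grading element of `l^ss` (we write
`E = (E − Ess) + Ess` with `E − Ess` central in `l` and `Ess = π^ss(E) ∈ l^ss`, so that
`Z = 2·Ess`).  Then `l` equals the centralizer `{ξ ∈ g : [2E − Z, ξ] = 0}`. -/
theorem stmt8 {L : Type*} [LieRing L] [LieAlgebra ℂ L] [FiniteDimensional ℂ L]
    [LieAlgebra.IsSemisimple ℂ L]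
    (H : LieSubalgebra ℂ L) [H.IsCartanSubalgebra]
    (R : Finset (Module.Dual ℂ H)) (hR0 : (0 : Module.Dual ℂ H) ∉ R)
    (hRne : ∀ α ∈ R, rootSp H α ≠ ⊥)
    (hindep : iSupIndep (fun o : Option {α // α ∈ R} =>
        o.elim H.toSubmodule (fun α => rootSp H (α : Module.Dual ℂ H))))
    (hsup : H.toSubmodule ⊔ (⨆ α ∈ R, rootSp H α) = ⊤)
    (S : Finset (Module.Dual ℂ H)) (hSR : S ⊆ R)
    (hSsimple : IsSimpleSystemFor H R ⊤ S)
    (E : H)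
    (hES : ∀ α ∈ S, α E = 1)
    (hEchar : ∀ α ∈ R, α E = 1 → α ∈ S)
    (hEint : ∀ α ∈ R, ∃ m : ℤ, α E = (m : ℂ))
    (l : Submodule ℂ L) (hl : IsLeviOf H R l)
    (Ess : L) (hEss : Ess ∈ commSpan l) (hEz : ((E : L) - Ess) ∈ centerOf l)
    (hdist : IsDistinguishedOn (commSpan l) ((2 : ℂ) • Ess)) :
    ∀ ξ : L, ξ ∈ l ↔ ⁅(2 : ℂ) • (E : L) - (2 : ℂ) • Ess, ξ⁆ = 0 := by
  obtain ⟨x, hlx, hlroot⟩ := hl.exists_mem_iff hsup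
  have hTH : (E : L) - Ess ∈ H := mem_of_forall_lie_eq_zero fun h =>
    hEz.2 h ((hlx h).2 (congrArg Subtype.val (trivial_lie_zero H H x h)))
  obtain ⟨e, rfl⟩ : ∃ e : H, (e : L) = Ess :=
    ⟨⟨Ess, by simpa using H.sub_mem E.2 hTH⟩, rfl⟩
  have he (w : L) (hw : w ∈ l) : ⁅(e : L), w⁆ = ⁅(E : L), w⁆ := by
    rw [eq_comm, ← sub_eq_zero, ← sub_lie]
    exact hEz.2 w hw
  have hmem (i) : (rootSystem H).root i ∈ R := root_mem_of_sup_rootSp_eq_top hsup i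
  have hrootof (α) (hα : α ∈ R) : ∃ i, (rootSystem H).root i = α :=
    exists_root_eq_of_rootSp_ne_bot (hRne α hα) (ne_of_mem_of_not_mem hα hR0)
  have hneg (α) (hα : α ∈ R) : -α ∈ R := by
    obtain ⟨i, rfl⟩ := hrootof α hα
    have h := hmem ((rootSystem H).reflectionPerm i i)
    rwa [RootPairing.root_reflectionPerm, RootPairing.reflection_apply_self] at h
  have hsumE (c : Dual ℂ H → ℕ) : (∑ β ∈ S, c β • β) E = ((∑ β ∈ S, c β : ℕ) : ℂ) := by
    rw [LinearMap.sum_apply, Nat.cast_sum]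
    exact Finset.sum_congr rfl fun β hβ => by simp [hES β hβ]
  -- Up to sign, every root is a combination of simple roots with positive height.
  have hpos (α) (hα : α ∈ R) : ∃ c : Dual ℂ H → ℕ, 0 < ∑ β ∈ S, c β ∧
      (α = ∑ β ∈ S, c β • β ∨ -α = ∑ β ∈ S, c β • β) := by
    obtain ⟨c, hc⟩ : ∃ c : Dual ℂ H → ℕ, α = ∑ β ∈ S, c β • β ∨ -α = ∑ β ∈ S, c β • β := by
      rcases hSsimple.2.2 α hα le_top with ⟨c, hc⟩ | ⟨c, hc⟩
      · exact ⟨c, .inl hc⟩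
      · exact ⟨c, .inr (by rw [hc, neg_neg])⟩
    refine ⟨c, Nat.pos_of_ne_zero fun h0 => hR0 ?_, hc⟩
    have hz : ∑ β ∈ S, c β • β = 0 := Finset.sum_eq_zero fun β hβ => by
      rw [Finset.sum_eq_zero_iff.1 h0 β hβ, zero_smul]
    rw [hz, neg_eq_zero, or_self] at hc
    rwa [← hc]
  have hE0 (α) (hα : α ∈ R) : α E ≠ 0 := by
    obtain ⟨c, hc, h | h⟩ := hpos α hα
    · rw [h, hsumE]
      exact_mod_cast hc.ne'
    · rw [← neg_ne_zero, ← LinearMap.neg_apply, h, hsumE]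
      exact_mod_cast hc.ne'
  have hker (y : H) (hy : ∀ γ ∈ S, γ x = 0 → γ y = 0) (α) (hα : α ∈ R) (hαx : α x = 0) :
      α y = 0 := by
    have key (β) (hβ : β ∈ R) (hβx : β x = 0) (n : ℕ) (hn : 0 < n) (hβE : β E = n) :
        β y = 0 := by
      obtain ⟨z, hz, hz0⟩ := Submodule.exists_mem_ne_zero_of_ne_bot (hRne β hβ)
      have h := hdist.lie_eq_zero_of_forall_simple hsup hEchar hlx he hy hβx hn hβE hz
      rw [hz y] at h
      exact (smul_eq_zero.1 h).resolve_right hz0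
    obtain ⟨c, hc, h | h⟩ := hpos α hα
    · exact key α hα hαx _ hc (by rw [h, hsumE])
    · simpa using key (-α) (hneg α hα) (by simp [hαx]) _ hc (by rw [h, hsumE])
  let s := {i : H.root // (rootSystem H).root i ∈ S ∧ (rootSystem H).root i x = 0}
  have : Fintype s := Fintype.ofFinite s
  have hespan : e ∈ Submodule.span ℂ (Set.range fun i : s => (rootSystem H).coroot i.1) := by
    refine mem_span_coroot_of_forall_killingForm_eq_zero _ e fun y hy => ?_
    have hy' (γ) (hγ : γ ∈ S) (hγx : γ x = 0) : γ y = 0 := by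
      obtain ⟨i, rfl⟩ := hrootof γ (hSR hγ)
      exact hy ⟨i, hγ, hγx⟩
    have hyl (w : L) (hw : w ∈ l) : ⁅w, (y : L)⁆ = 0 := by
      have h := mem_biSup_rootSp_of_lie_eq_smul (h := x) (ν := 0)
        (mem_biSup_rootSp_insert_zero hsup w) (by rw [zero_smul, (hlx w).1 hw])
      rw [← lie_skew, neg_eq_zero, ← zero_smul ℂ w]
      refine lie_eq_smul_of_mem_biSup_rootSp ?_ h
      rintro α ⟨rfl | hα, hαx⟩
      · rfl
      · exact hker y hy' α hα hαx
    have hle : commSpan l ≤ LinearMap.ker ((killingForm ℂ L).flip (y : L)) := by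
      refine Submodule.span_le.2 ?_
      rintro _ ⟨u, hu, v, hv, rfl⟩
      change killingForm ℂ L ⁅u, v⁆ y = 0
      rw [LieModule.traceForm_apply_lie_apply, hyl v hv, map_zero]
    exact hle hEss
  obtain ⟨c, hc⟩ := (Submodule.mem_span_range_iff_exists_fun ℂ).1 hespan
  have heval (k : H.root) : (rootSystem H).root k e
      = ∑ j : s, c j * (rootSystem H).pairing k j.1 := by
    rw [← hc, map_sum]
    exact Finset.sum_congr rfl fun j _ => by simp
  have hoff (i j : H.root) (hi : (rootSystem H).root i ∈ S) (hj : (rootSystem H).root j ∈ S)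
      (hij : i ≠ j) : (rootSystem H).pairingIn ℤ i j ≤ 0 := by
    by_contra! hlt
    obtain ⟨k, hk⟩ := (rootSystem H).root_sub_root_mem_of_pairingIn_pos hlt hij
    exact hE0 _ (hmem k) (by rw [hk, LinearMap.sub_apply, hES _ hi, hES _ hj, sub_self])
  have heE (α) (hα : α ∈ R) (hαx : α x = 0) : α e = α E := by
    obtain ⟨z, hz, hz0⟩ := Submodule.exists_mem_ne_zero_of_ne_bot (hRne α hα)
    have h := he z (hlroot α hαx hz)
    rw [hz e, hz E] at h
    exact smul_left_injective ℂ hz0 h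
  have hcnonneg := (rootSystem H).re_nonneg_of_forall_re_sum_pairing_pos
    (fun i : s => i.1) (fun i j hij => hoff _ _ i.2.1 j.2.1 (Subtype.coe_injective.ne hij)) c
    fun i => by rw [← heval, heE _ (hmem _) i.2.2, hES _ i.2.1]; simp
  have hneg' (β) (hβ : β ∈ S) (hβx : β x ≠ 0) : (β e).re ≤ 0 := by
    obtain ⟨k, rfl⟩ := hrootof β (hSR hβ)
    rw [heval, Complex.re_sum]
    refine Finset.sum_nonpos fun j _ => ?_
    have hkj : k ≠ j.1 := fun h => hβx (h ▸ j.2.2)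
    rw [← (rootSystem H).algebraMap_pairingIn ℤ]
    have : ((rootSystem H).pairingIn ℤ k j.1 : ℝ) ≤ 0 := by
      exact_mod_cast hoff _ _ hβ j.2.1 hkj
    simpa using mul_nonpos_of_nonneg_of_nonpos (hcnonneg j) this
  have hkey (α) (hα : α ∈ R) (hαT : α (E - e) = 0) : α x = 0 := by
    have key (c : Dual ℂ H → ℕ) (h : (∑ β ∈ S, c β • β) (E - e) = 0) :
        (∑ β ∈ S, c β • β) x = 0 := by
      have hre (β) (hβ : β ∈ S) : 0 ≤ (β (E - e)).re ∧ (β x ≠ 0 → 0 < (β (E - e)).re) := by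
        by_cases hβx : β x = 0
        · simp [hβx, heE β (hSR hβ) hβx]
        · have := hneg' β hβ hβx
          simp only [map_sub, hES β hβ, Complex.sub_re, Complex.one_re]
          exact ⟨by linarith, fun _ => by linarith⟩
      have h' := congrArg Complex.re h
      simp only [LinearMap.sum_apply, LinearMap.smul_apply, Complex.re_sum, nsmul_eq_mul,
        Complex.mul_re, Complex.natCast_re, Complex.natCast_im, zero_mul, sub_zero,
        Complex.zero_re] at h'
      rw [Finset.sum_eq_zero_iff_of_nonneg
        fun β hβ => mul_nonneg (Nat.cast_nonneg _) (hre β hβ).1] at h'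
      rw [LinearMap.sum_apply]
      refine Finset.sum_eq_zero fun β hβ => ?_
      by_cases hβx : β x = 0
      · simp [hβx]
      · have := (mul_eq_zero.1 (h' β hβ)).resolve_right ((hre β hβ).2 hβx).ne'
        simp [Nat.cast_eq_zero.1 this]
    obtain ⟨c, -, h | h⟩ := hpos α hα
    · rw [h] at hαT ⊢
      exact key c hαT
    · rw [← neg_eq_zero, ← LinearMap.neg_apply] at hαT ⊢
      rw [h] at hαT ⊢
      exact key c hαT
  intro ξ
  rw [← smul_sub, smul_lie, smul_eq_zero_iff_right two_ne_zero]
  refine ⟨fun hξ => hEz.2 ξ hξ, fun hξ => ?_⟩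
  have h := mem_biSup_rootSp_of_lie_eq_smul (h := E - e) (ν := 0)
    (mem_biSup_rootSp_insert_zero hsup ξ) (by rw [zero_smul]; exact hξ)
  refine (iSup₂_le ?_ : _ ≤ l) h
  rintro α ⟨rfl | hα, hαT⟩
  · exact hlroot 0 rfl
  · exact hlroot α (hkey α hα hαT)
end
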